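/- arXiv:2004.09605 — 14 statements merged into one kernel-verified Lean document; each statement's English description precedes it below -/
import Mathlib

section
/- Let n ≥ 1 and let a_1, …, a_n be positive integers. The Hats game on the complete graph K_n, in which the vertex i has hatness a_i, is winning if and only if 1/a_1 + 1/a_2 + … + 1/a_n ≥ 1 (as rational numbers). -/
/-- The Hats game `⟨G, h⟩` is winning: there is a strategy (one guessing function per
vertex, whose value depends only on the hats of its neighbors) such that for every
hat arrangement some vertex guesses its own hat color correctly. -/
def HatsWinning {V : Type*} (G : SimpleGraph V) (h : V → ℕ) : Prop :=
  ∃ f : (v : V) → ((u : V) → Fin (h u)) → Fin (h v),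
    (∀ (v : V) (φ ψ : (u : V) → Fin (h u)),
        (∀ u : V, G.Adj v u → φ u = ψ u) → f v φ = f v ψ) ∧
    ∀ φ : (u : V) → Fin (h u), ∃ v : V, f v φ = φ v

/-- A vertex which does not look at its own hat guesses correctly on at most a fraction
`1 / h v` of all hat arrangements. -/
theorem card_correct_mul_hatness_le {V : Type*} [Fintype V] [DecidableEq V] (h : V → ℕ) (v : V)
    (g : ((u : V) → Fin (h u)) → Fin (h v))
    (hg : ∀ φ ψ : (u : V) → Fin (h u), (∀ u, u ≠ v → φ u = ψ u) → g φ = g ψ) :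
    (Finset.univ.filter fun φ => g φ = φ v).card * h v ≤ ∏ u, h u := by
  have key := Finset.card_le_card_of_injOn
    (s := (Finset.univ.filter fun φ => g φ = φ v) ×ˢ (Finset.univ : Finset (Fin (h v))))
    (t := (Finset.univ : Finset ((u : V) → Fin (h u))))
    (fun p => Function.update p.1 v p.2) (fun _ _ => Finset.mem_coe.2 (Finset.mem_univ _)) ?_
  · simpa [Finset.card_product, Fintype.card_pi] using key
  · rintro ⟨φ, c⟩ hφ ⟨ψ, d⟩ hψ heq
    simp only [Finset.coe_product, Set.mem_prod, Finset.mem_coe, Finset.mem_filter,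
      Finset.mem_univ, true_and, and_true] at hφ hψ
    have hcd : c = d := by simpa using congrFun heq v
    have hne : ∀ u, u ≠ v → φ u = ψ u := fun u hu => by
      simpa [Function.update_of_ne hu] using congrFun heq u
    have hφψ : φ = ψ := by
      funext u
      by_cases hu : u = v
      · subst hu
        rw [← hφ, ← hψ, hg φ ψ hne]
      · exact hne u hu
    rw [hφψ, hcd]

/-- Consecutive intervals of lengths `w 0, w 1, …` starting at `0` cover `[0, ∑ i, w i)`. -/
theorem exists_sum_Iio_le_lt {n : ℕ} (w : Fin n → ℤ) (r : ℤ) (h0 : 0 ≤ r)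
    (hr : r < ∑ i, w i) :
    ∃ i, ∑ j ∈ Finset.Iio i, w j ≤ r ∧ r < ∑ j ∈ Finset.Iio i, w j + w i := by
  induction n with
  | zero => simp at hr; omega
  | succ n ih =>
    by_cases hlt : r < ∑ i : Fin n, w i.castSucc
    · obtain ⟨i, hi⟩ := ih (fun i => w i.castSucc) hlt
      refine ⟨i.castSucc, ?_⟩
      rwa [← Fin.map_castSuccEmb_Iio, Finset.sum_map]
    · refine ⟨Fin.last n, ?_⟩
      have hsum : ∑ j ∈ Finset.Iio (Fin.last n), w j = ∑ i : Fin n, w i.castSucc := by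
        rw [Fin.Iio_last_eq_map, Finset.sum_map]
        rfl
      rw [Fin.sum_univ_castSucc] at hr
      rw [hsum]
      exact ⟨not_lt.1 hlt, hr⟩

/-- If `t + c * w` lies in `[p, p + w)` modulo `a * w`, where `0 ≤ c < a`, then `c` is
determined by `t`, `p`, `w` and `a`. -/
theorem neg_ediv_emod_eq {a w t p c : ℤ} (hw : 0 < w) (hc0 : 0 ≤ c) (hca : c < a)
    (h1 : p ≤ (t + c * w) % (a * w)) (h2 : (t + c * w) % (a * w) < p + w) :
    (-((t - p) / w)) % a = c := by
  have hdiv := Int.emod_add_mul_ediv (t + c * w) (a * w)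
  set r := (t + c * w) % (a * w)
  set q := (t + c * w) / (a * w)
  have ht : t - p = (r - p) + (a * q - c) * w := by linear_combination -hdiv
  rw [ht, Int.add_mul_ediv_right _ _ hw.ne', Int.ediv_eq_zero_of_lt (by omega) (by omega)]
  have hneg : -(0 + (a * q - c)) = c + a * (-q) := by ring
  rw [hneg, Int.add_mul_emod_self_left, Int.emod_eq_of_lt hc0 hca]

theorem one_le_sum_of_hatsWinning {V : Type*} [Fintype V] (h : V → ℕ) (hpos : ∀ v, 0 < h v)
    (G : SimpleGraph V) (hG : HatsWinning G h) : 1 ≤ ∑ v, (1 : ℚ) / (h v : ℚ) := by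
  classical
  obtain ⟨f, hf, hwin⟩ := hG
  have hN : (0 : ℚ) < ∏ v, (h v : ℚ) := Finset.prod_pos fun v _ => by exact_mod_cast hpos v
  have hcover : ∏ v, h v ≤ ∑ v, (Finset.univ.filter fun φ => f v φ = φ v).card := by
    calc ∏ v, h v = (Finset.univ : Finset ((u : V) → Fin (h u))).card := by
          simp [Fintype.card_pi]
      _ ≤ (Finset.univ.biUnion fun v => Finset.univ.filter fun φ => f v φ = φ v).card := by
          refine Finset.card_le_card fun φ _ => ?_
          simpa using hwin φ
      _ ≤ _ := Finset.card_biUnion_le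
  have hcard : ∀ v, ((Finset.univ.filter fun φ => f v φ = φ v).card : ℚ) ≤
      (∏ u, (h u : ℚ)) * (1 / (h v : ℚ)) := fun v => by
    have hv : (0 : ℚ) < h v := by exact_mod_cast hpos v
    rw [mul_one_div, le_div_iff₀ hv]
    exact_mod_cast card_correct_mul_hatness_le h v (f v)
      fun φ ψ hφψ => hf v φ ψ fun u hu => hφψ u hu.ne'
  have hle : (∏ v, (h v : ℚ)) * 1 ≤ (∏ v, (h v : ℚ)) * ∑ v, (1 : ℚ) / (h v : ℚ) := by
    rw [mul_one, Finset.mul_sum]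
    refine le_trans ?_ (Finset.sum_le_sum fun v _ => hcard v)
    exact_mod_cast hcover
  exact le_of_mul_le_mul_left hle hN

theorem hatsWinning_top_of_one_le_sum {n : ℕ} (a : Fin n → ℕ) (ha : ∀ i, 0 < a i)
    (hsum : 1 ≤ ∑ i, (1 : ℚ) / (a i : ℚ)) : HatsWinning (⊤ : SimpleGraph (Fin n)) a := by
  have haz : ∀ i, (0 : ℤ) < a i := fun i => by exact_mod_cast ha i
  set N : ℤ := ∏ i, (a i : ℤ)
  have hN : 0 < N := Finset.prod_pos fun i _ => haz i
  set w : Fin n → ℤ := fun i => ∏ j ∈ Finset.univ.erase i, (a j : ℤ)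
  have hw : ∀ i, 0 < w i := fun i => Finset.prod_pos fun j _ => haz j
  have haw : ∀ i, (a i : ℤ) * w i = N := fun i =>
    Finset.mul_prod_erase _ (fun j => (a j : ℤ)) (Finset.mem_univ i)
  have hNw : N ≤ ∑ i, w i := by
    have hwq : ∀ i, (w i : ℚ) = N * (1 / (a i : ℚ)) := fun i => by
      have hi : (a i : ℚ) ≠ 0 := by exact_mod_cast (ha i).ne'
      rw [← haw i]
      push_cast
      field_simp
    have hq : (N : ℚ) ≤ ∑ i, (w i : ℚ) := by
      simp only [hwq]
      rw [← Finset.mul_sum]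
      exact le_mul_of_one_le_right (by exact_mod_cast hN.le) hsum
    exact_mod_cast hq
  set others : Fin n → ((j : Fin n) → Fin (a j)) → ℤ :=
    fun i φ => ∑ j ∈ Finset.univ.erase i, ((φ j : ℕ) : ℤ) * w j
  set guess : Fin n → ((j : Fin n) → Fin (a j)) → ℤ :=
    fun i φ => (-((others i φ - ∑ j ∈ Finset.Iio i, w j) / w i)) % (a i : ℤ) with hguess
  refine ⟨fun i φ => ⟨(guess i φ).toNat, ?_⟩, ?_, ?_⟩
  · have := Int.emod_lt_of_pos (-((others i φ - ∑ j ∈ Finset.Iio i, w j) / w i)) (haz i)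
    exact (Int.toNat_lt' (ha i)).2 this
  · intro i φ ψ hφψ
    have ho : others i φ = others i ψ := Finset.sum_congr rfl fun j hj => by
      rw [hφψ j (Finset.ne_of_mem_erase hj).symm]
    simp only [hguess, ho]
  · intro φ
    obtain ⟨i, h1, h2⟩ := exists_sum_Iio_le_lt w ((∑ j, ((φ j : ℕ) : ℤ) * w j) % N)
      (Int.emod_nonneg _ hN.ne') ((Int.emod_lt_of_pos _ hN).trans_le hNw)
    refine ⟨i, Fin.ext ?_⟩
    rw [← Finset.sum_erase_add _ _ (Finset.mem_univ i), ← haw i] at h1 h2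
    have hg : guess i φ = ((φ i : ℕ) : ℤ) :=
      neg_ediv_emod_eq (hw i) (by positivity) (by exact_mod_cast (φ i).isLt) h1 h2
    simp [hg]

theorem clique_winning_iff (n : ℕ) (hn : 1 ≤ n) (a : Fin n → ℕ) (ha : ∀ i, 0 < a i) :
    HatsWinning (⊤ : SimpleGraph (Fin n)) a ↔ 1 ≤ ∑ i, (1 : ℚ) / (a i : ℚ) :=
  ⟨one_le_sum_of_hatsWinning a ha _, hatsWinning_top_of_one_le_sum a ha⟩
end

section
/- A strategy for the Hats game ⟨G,h⟩ is called precise if for every hat arrangement exactly one vertex guesses its own color correctly. A precise winning strategy for ⟨G,h⟩ exists if and only if G is a complete graph and the hatnesses satisfy 1/h(v_1) + 1/h(v_2) + … + 1/h(v_n) = 1, where v_1, …, v_n are the vertices of G. -/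
/-- A family of lengths `d` is realised by intervals `[a v, a v + d v)` that partition
`[0, ∑ v ∈ s, d v)`. -/
theorem exists_interval_partition {V : Type*} [DecidableEq V] (d : V → ℕ) (s : Finset V) :
    ∃ a : V → ℕ, (∀ v ∈ s, a v + d v ≤ ∑ u ∈ s, d u) ∧
      ∀ x < ∑ u ∈ s, d u, ∃! v, v ∈ s ∧ a v ≤ x ∧ x < a v + d v := by
  induction s using Finset.induction_on with
  | empty => exact ⟨fun _ => 0, by simp, by simp⟩
  | insert w s hw ih =>
    obtain ⟨a, ha, hx⟩ := ih
    have hne : ∀ v ∈ s, v ≠ w := fun v hv hvw => hw (hvw ▸ hv)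
    refine ⟨Function.update a w (∑ u ∈ s, d u), ?_, ?_⟩
    · intro v hv
      rw [Finset.sum_insert hw]
      rcases Finset.mem_insert.1 hv with rfl | hv
      · rw [Function.update_self]
        omega
      · rw [Function.update_of_ne (hne v hv)]
        have := ha v hv
        omega
    · intro x hxlt
      rw [Finset.sum_insert hw] at hxlt
      by_cases hlt : x < ∑ u ∈ s, d u
      · obtain ⟨v, ⟨hv, hv1⟩, huniq⟩ := hx x hlt
        refine ⟨v, ⟨Finset.mem_insert_of_mem hv, ?_⟩, ?_⟩
        · rwa [Function.update_of_ne (hne v hv)]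
        · rintro u ⟨hu, hu1⟩
          rcases Finset.mem_insert.1 hu with rfl | hu
          · rw [Function.update_self] at hu1
            omega
          · rw [Function.update_of_ne (hne u hu)] at hu1
            exact huniq u ⟨hu, hu1⟩
      · refine ⟨w, ⟨Finset.mem_insert_self _ _, ?_⟩, ?_⟩
        · rw [Function.update_self]
          omega
        · rintro u ⟨hu, hu1⟩
          rcases Finset.mem_insert.1 hu with rfl | hu
          · rfl
          · rw [Function.update_of_ne (hne u hu)] at hu1
            have := ha u hu
            omega

/-- The translates of `r` by multiples of `d`, taken modulo `k * d`, meet each interval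
of length `d` exactly once. -/
theorem existsUnique_translate_mem_interval {k d a : ℕ} (hk : 0 < k) (hd : 0 < d)
    (had : a + d ≤ k * d) (r : ℕ) :
    ∃! c : Fin k, a ≤ (r + c * d) % (k * d) ∧ (r + c * d) % (k * d) < a + d := by
  have hdZ : (0 : ℤ) < d := by exact_mod_cast hd
  have hkZ : (0 : ℤ) < k := by exact_mod_cast hk
  refine existsUnique_of_exists_of_unique ?_ ?_
  · obtain ⟨q, j, hj0, hjd, hq⟩ : ∃ q j : ℤ, 0 ≤ j ∧ j < d ∧ (r : ℤ) + q * d = a + j :=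
      ⟨-((r - a : ℤ) / d), (r - a : ℤ) % d, Int.emod_nonneg _ hdZ.ne', Int.emod_lt_of_pos _ hdZ, by
        linarith [Int.emod_add_mul_ediv (r - a : ℤ) d]⟩
    have hc0 : 0 ≤ q % k := Int.emod_nonneg _ hkZ.ne'
    have hck : q % k < k := Int.emod_lt_of_pos _ hkZ
    obtain ⟨c, hc⟩ := Int.eq_ofNat_of_zero_le hc0
    have hadZ : (a : ℤ) + d ≤ k * d := by exact_mod_cast had
    have key : ((r : ℤ) + c * d) % (k * d) = a + j := by
      have : (r : ℤ) + c * d = a + j + k * d * (-(q / k)) := by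
        rw [← hc, ← hq, Int.emod_def]
        ring
      rw [this, Int.add_mul_emod_self_left]
      exact Int.emod_eq_of_lt (by omega) (by omega)
    refine ⟨⟨c, by omega⟩, ?_, ?_⟩
    · zify
      rw [key]
      omega
    · zify
      rw [key]
      omega
  · rintro c b ⟨h1, h2⟩ ⟨h3, h4⟩
    have hmod : (r + c * d) % (k * d) ≡ (r + b * d) % (k * d) [MOD d] := by
      have (e : ℕ) : (r + e * d) % (k * d) ≡ r [MOD d] := by
        unfold Nat.ModEq
        rw [Nat.mod_mod_of_dvd _ (Dvd.intro_left k rfl), Nat.add_mul_mod_self_right]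
      exact (this c).trans (this b).symm
    have heq : (r + c * d) % (k * d) = (r + b * d) % (k * d) :=
      hmod.eq_of_abs_lt (by rw [abs_lt]; omega)
    have hcc : c * d ≡ b * d [MOD k * d] := Nat.ModEq.add_left_cancel' r heq
    have := Nat.ModEq.mul_right_cancel' hd.ne' hcc
    exact Fin.ext (this.eq_of_lt_of_lt c.2 b.2)

/-- In a precise strategy any two distinct vertices see each other. -/
theorem adj_of_precise {V : Type*} {G : SimpleGraph V} {h : V → ℕ} (hpos : ∀ v, 0 < h v)
    {f : (v : V) → ((u : V) → Fin (h u)) → Fin (h v)}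
    (hf : ∀ (v : V) (φ ψ : (u : V) → Fin (h u)),
      (∀ u : V, G.Adj v u → φ u = ψ u) → f v φ = f v ψ)
    (hprec : ∀ φ : (u : V) → Fin (h u), ∃! v : V, f v φ = φ v) {u v : V} (huv : u ≠ v) :
    G.Adj u v := by
  classical
  by_contra hadj
  let φ : (w : V) → Fin (h w) := fun w => ⟨0, hpos w⟩
  let ψ := Function.update (Function.update φ u (f u φ)) v (f v φ)
  have hψ (w : V) (hu : w ≠ u) (hv : w ≠ v) : φ w = ψ w := by simp [ψ, hu, hv]
  have h1 : f u φ = f u ψ := hf u φ ψ fun w hw =>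
    hψ w hw.ne' fun hwv => hadj (hwv ▸ hw)
  have h2 : f v φ = f v ψ := hf v φ ψ fun w hw =>
    hψ w (fun hwu => hadj (hwu ▸ hw).symm) hw.ne'
  exact huv ((hprec ψ).unique (by rw [← h1]; simp [ψ, huv]) (by rw [← h2]; simp [ψ]))

/-- A guess at `v` that ignores the color of `v` is correct with frequency `1 / h v`. -/
theorem card_correct_guess_mul {V : Type*} [Fintype V] [DecidableEq V] {h : V → ℕ} (v : V)
    (g : ((u : V) → Fin (h u)) → Fin (h v))
    (hg : ∀ φ c, g (Function.update φ v c) = g φ) :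
    Fintype.card {φ : (u : V) → Fin (h u) // g φ = φ v} * h v =
      Fintype.card ((u : V) → Fin (h u)) := by
  let e : {φ : (u : V) → Fin (h u) // g φ = φ v} × Fin (h v) ≃ ((u : V) → Fin (h u)) :=
    { toFun := fun p => Function.update p.1.1 v p.2
      invFun := fun ψ => (⟨Function.update ψ v (g ψ), by simp [hg]⟩, ψ v)
      left_inv := by
        rintro ⟨⟨φ, hφ⟩, c⟩
        simp [hg, hφ]
      right_inv := fun ψ => by simp }
  simpa using Fintype.card_congr e

/-- The reciprocals of the hatnesses sum to `1` if there is a precise strategy. -/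
theorem sum_one_div_eq_one_of_precise {V : Type*} [Fintype V] {h : V → ℕ}
    (hpos : ∀ v, 0 < h v) {f : (v : V) → ((u : V) → Fin (h u)) → Fin (h v)}
    (hf : ∀ (v : V) (φ ψ : (u : V) → Fin (h u)),
      (∀ u : V, u ≠ v → φ u = ψ u) → f v φ = f v ψ)
    (hprec : ∀ φ : (u : V) → Fin (h u), ∃! v : V, f v φ = φ v) :
    ∑ v, (1 : ℚ) / (h v : ℚ) = 1 := by
  classical
  have hT : (Fintype.card ((u : V) → Fin (h u)) : ℚ) ≠ 0 := by
    have : Nonempty ((u : V) → Fin (h u)) := ⟨fun u => ⟨0, hpos u⟩⟩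
    exact_mod_cast Fintype.card_ne_zero
  have hcard : ∑ v, Fintype.card {φ : (u : V) → Fin (h u) // f v φ = φ v} =
      Fintype.card ((u : V) → Fin (h u)) := by
    simp only [Fintype.card_subtype, Finset.card_filter]
    rw [Finset.sum_comm, Fintype.card, Finset.card_eq_sum_ones]
    refine Finset.sum_congr rfl fun φ _ => ?_
    obtain ⟨v, hv, huniq⟩ := hprec φ
    rw [Finset.sum_eq_single v (fun u _ hu => if_neg fun hu' => hu (huniq u hu')) (by simp),
      if_pos hv]
  have hterm (v : V) : (1 : ℚ) / (h v : ℚ) =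
      Fintype.card {φ : (u : V) → Fin (h u) // f v φ = φ v} /
        Fintype.card ((u : V) → Fin (h u)) := by
    have hv : (h v : ℚ) ≠ 0 := by exact_mod_cast (hpos v).ne'
    rw [div_eq_div_iff hv hT, one_mul]
    exact_mod_cast (card_correct_guess_mul v (f v) fun φ c =>
      hf v _ _ fun u hu => Function.update_of_ne hu _ _).symm
  rw [Finset.sum_congr rfl fun v _ => hterm v, ← Finset.sum_div, ← Nat.cast_sum, hcard, div_self hT]

/-- If the reciprocals of the hatnesses sum to `1`, there is a precise strategy in which
every vertex sees all the others. -/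
theorem exists_precise_of_sum_one_div_eq_one {V : Type*} [Fintype V] {h : V → ℕ}
    (hpos : ∀ v, 0 < h v) (hsum : ∑ v, (1 : ℚ) / (h v : ℚ) = 1) :
    ∃ f : (v : V) → ((u : V) → Fin (h u)) → Fin (h v),
      (∀ (v : V) (φ ψ : (u : V) → Fin (h u)),
        (∀ u : V, u ≠ v → φ u = ψ u) → f v φ = f v ψ) ∧
      ∀ φ : (u : V) → Fin (h u), ∃! v : V, f v φ = φ v := by
  classical
  let N := ∏ v, h v
  let d : V → ℕ := fun v => ∏ u ∈ Finset.univ.erase v, h u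
  have hN : 0 < N := Finset.prod_pos fun v _ => hpos v
  have hd (v : V) : 0 < d v := Finset.prod_pos fun u _ => hpos u
  have hhd (v : V) : h v * d v = N := Finset.mul_prod_erase _ _ (Finset.mem_univ v)
  have hdN : ∑ v, d v = N := by
    have hterm (v : V) : (d v : ℚ) = N * (1 / h v) := by
      have hv : (h v : ℚ) ≠ 0 := by exact_mod_cast (hpos v).ne'
      rw [← hhd v]
      push_cast
      field_simp
    have : ((∑ v, d v : ℕ) : ℚ) = N := by
      rw [Nat.cast_sum, Finset.sum_congr rfl fun v _ => hterm v, ← Finset.mul_sum, hsum, mul_one]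
    exact_mod_cast this
  obtain ⟨a, ha, hpart⟩ := exists_interval_partition d Finset.univ
  rw [hdN] at ha hpart
  have htrans (v : V) (r : ℕ) :
      ∃! c : Fin (h v), a v ≤ (r + c * d v) % N ∧ (r + c * d v) % N < a v + d v := by
    have := existsUnique_translate_mem_interval (hpos v) (hd v)
      ((ha v (Finset.mem_univ v)).trans_eq (hhd v).symm) r
    rwa [hhd v] at this
  choose g hg hguniq using htrans
  refine ⟨fun v φ => g v (∑ u ∈ Finset.univ.erase v, φ u * d u), ?_, ?_⟩
  · intro v φ ψ hφψ
    refine congrArg (g v) (Finset.sum_congr rfl fun u hu => ?_)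
    rw [hφψ u (Finset.ne_of_mem_erase hu)]
  · intro φ
    have hiff (v : V) : g v (∑ u ∈ Finset.univ.erase v, φ u * d u) = φ v ↔
        v ∈ Finset.univ ∧ a v ≤ (∑ u, φ u * d u) % N ∧ (∑ u, φ u * d u) % N < a v + d v := by
      rw [← Finset.sum_erase_add _ _ (Finset.mem_univ v)]
      refine ⟨fun heq => ⟨Finset.mem_univ v, ?_⟩, fun hv => (hguniq v _ _ hv.2).symm⟩
      rw [← heq]
      exact hg v _
    simp only [hiff]
    exact hpart _ (Nat.mod_lt _ hN)

/-- A precise winning strategy (every hat arrangement has exactly one correct guess)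
exists iff `G` is complete and the reciprocals of the hatnesses sum to 1. -/
theorem precise_strategy_iff {V : Type*} [Fintype V] (G : SimpleGraph V) (h : V → ℕ)
    (hpos : ∀ v, 0 < h v) :
    (∃ f : (v : V) → ((u : V) → Fin (h u)) → Fin (h v),
        (∀ (v : V) (φ ψ : (u : V) → Fin (h u)),
            (∀ u : V, G.Adj v u → φ u = ψ u) → f v φ = f v ψ) ∧
        ∀ φ : (u : V) → Fin (h u), ∃! v : V, f v φ = φ v) ↔
      (G = ⊤ ∧ ∑ v, (1 : ℚ) / (h v : ℚ) = 1) := by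
  constructor
  · rintro ⟨f, hf, hprec⟩
    refine ⟨?_, sum_one_div_eq_one_of_precise hpos
      (fun v φ ψ hφψ => hf v φ ψ fun u hu => hφψ u hu.ne') hprec⟩
    ext u v
    exact ⟨fun huv => huv.ne, fun huv => adj_of_precise hpos hf hprec huv⟩
  · rintro ⟨rfl, hsum⟩
    obtain ⟨f, hf, hprec⟩ := exists_precise_of_sum_one_div_eq_one hpos hsum
    exact ⟨f, fun v φ ψ hφψ => hf v φ ψ fun u hu => hφψ u hu.symm, hprec⟩
end

section
/- Let n ≥ 2 and let G be the almost complete graph obtained from the complete graph K_n on vertices A_1, …, A_n by removing the edge A_{n−1}A_n, and let the vertex A_i have hatness a_i (a positive integer). If the Hats game on G is winning, then 1/a_1 + 1/a_2 + … + 1/a_n − 1/(a_{n−1}·a_n) ≥ 1 (as rational numbers). -/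
open Finset Function in
/-- If a set of arrangements is stable under changing the hat at `v`, and `g` does not depend on
the hat at `v`, then `g` guesses the hat at `v` correctly on a fraction `1 / h v` of the set. -/
theorem card_filter_eq_apply_mul {V : Type*} [DecidableEq V] {h : V → ℕ} (v : V)
    (T : Finset ((u : V) → Fin (h u))) (hT : ∀ φ ∈ T, ∀ c, update φ v c ∈ T)
    (g : ((u : V) → Fin (h u)) → Fin (h v)) (hg : ∀ φ c, g (update φ v c) = g φ) :
    #{φ ∈ T | g φ = φ v} * h v = #T := by
  have key : #({φ ∈ T | g φ = φ v} ×ˢ (univ : Finset (Fin (h v)))) = #T := by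
    refine card_nbij' (fun p => update p.1 v p.2) (fun ψ => (update ψ v (g ψ), ψ v)) ?_ ?_ ?_ ?_
    · rintro ⟨φ, c⟩ hp
      simp only [coe_product, Set.mem_prod, mem_coe, mem_filter] at hp
      exact hT φ hp.1.1 c
    · intro ψ hψ
      simp only [mem_coe, mem_product, mem_filter, mem_univ, and_true]
      exact ⟨hT ψ hψ _, by simp [hg]⟩
    · rintro ⟨φ, c⟩ hp
      simp only [coe_product, Set.mem_prod, mem_coe, mem_filter] at hp
      simp [hg, hp.1.2]
    · intro ψ _
      simp
  simpa [card_product] using key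

open Finset Function in
/-- A winning game on a finite graph with two distinct non-adjacent vertices `x` and `y` satisfies
the inequality given by the union bound corrected by the independence of the guesses at `x`
and `y`. -/
theorem HatsWinning.one_le_sum_sub {V : Type*} [Fintype V] [DecidableEq V] {G : SimpleGraph V}
    {h : V → ℕ} (hwin : HatsWinning G h) (hpos : ∀ v, 0 < h v) {x y : V} (hxy : x ≠ y)
    (hadj : ¬ G.Adj x y) :
    1 ≤ (∑ v, (1 : ℚ) / (h v : ℚ)) - 1 / ((h x : ℚ) * (h y : ℚ)) := by
  obtain ⟨f, hf, hw⟩ := hwin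
  have inv : ∀ v u, ¬ G.Adj v u → ∀ φ c, f v (update φ u c) = f v φ := by
    intro v u hvu φ c
    refine hf v _ _ fun w hvw => update_of_ne ?_ _ _
    rintro rfl
    exact hvu hvw
  let S : V → Finset ((u : V) → Fin (h u)) := fun v => {φ | f v φ = φ v}
  have hS : ∀ v, #(S v) * h v = #(univ : Finset ((u : V) → Fin (h u))) := fun v =>
    card_filter_eq_apply_mul v univ (by simp) (f v) (inv v v (G.irrefl))
  have hSS : #{φ ∈ S x | f y φ = φ y} * h y = #(S x) := by
    refine card_filter_eq_apply_mul y (S x) ?_ (f y) (inv y y (G.irrefl))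
    intro φ hφ c
    simp only [S, mem_filter, mem_univ, true_and] at hφ ⊢
    rw [inv x y hadj, update_of_ne hxy, hφ]
  have hinter : {φ ∈ S x | f y φ = φ y} = S y ∩ S x := by
    ext φ
    simp [S, and_comm]
  rw [hinter] at hSS
  have hcover : (univ : Finset ((u : V) → Fin (h u))) ⊆
      (univ.erase y).biUnion S ∪ (S y \ S x) := by
    intro φ _
    obtain ⟨v, hv⟩ := hw φ
    have hvS : φ ∈ S v := by simpa [S] using hv
    by_cases hx : φ ∈ S x
    · exact mem_union_left _ (mem_biUnion.2 ⟨x, by simp [hxy], hx⟩)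
    · rcases eq_or_ne v y with rfl | hvy
      · exact mem_union_right _ (mem_sdiff.2 ⟨hvS, hx⟩)
      · exact mem_union_left _ (mem_biUnion.2 ⟨v, by simp [hvy], hvS⟩)
  have hle : #(univ : Finset ((u : V) → Fin (h u))) + #(S y ∩ S x) ≤ ∑ v, #(S v) := by
    have h1 := (card_le_card hcover).trans (card_union_le _ _)
    have h2 : #((univ.erase y).biUnion S) ≤ ∑ v ∈ univ.erase y, #(S v) := card_biUnion_le
    have h3 := card_sdiff_add_card_inter (S y) (S x)
    have h4 := sum_erase_add univ (fun v => #(S v)) (mem_univ y)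
    omega
  have hN : (0 : ℚ) < (#(univ : Finset ((u : V) → Fin (h u))) : ℚ) := by
    have : Nonempty ((u : V) → Fin (h u)) := ⟨fun u => ⟨0, hpos u⟩⟩
    exact_mod_cast card_pos.2 univ_nonempty
  generalize #(univ : Finset ((u : V) → Fin (h u))) = N at hS hle hN
  have hh : ∀ v, (h v : ℚ) ≠ 0 := fun v => by exact_mod_cast (hpos v).ne'
  have hSq : ∀ v, (#(S v) : ℚ) = N * (1 / h v) := by
    intro v
    rw [mul_one_div, eq_div_iff (hh v)]
    exact_mod_cast hS v
  have hSSq : (#(S y ∩ S x) : ℚ) = N * (1 / (h x * h y)) := by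
    rw [mul_one_div, eq_div_iff (mul_ne_zero (hh x) (hh y)), mul_comm (h x : ℚ), ← mul_assoc]
    exact_mod_cast (congrArg (· * h x) hSS).trans (hS x)
  have hleq : (N : ℚ) + #(S y ∩ S x) ≤ ∑ v, (#(S v) : ℚ) := by exact_mod_cast hle
  simp only [hSq, hSSq, ← mul_sum] at hleq
  refine le_of_mul_le_mul_left ?_ hN
  linarith

/-- Necessary condition for the sages to win on the almost complete graph
`K_n` minus the edge `A_{n-1} A_n`. -/
theorem almost_clique_necessary (n : ℕ) (hn : 2 ≤ n) (a : Fin n → ℕ) (ha : ∀ i, 0 < a i)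
    (hwin : HatsWinning
      ((⊤ : SimpleGraph (Fin n)).deleteEdges
        {s((⟨n - 2, by omega⟩ : Fin n), (⟨n - 1, by omega⟩ : Fin n))}) a) :
    1 ≤ (∑ i, (1 : ℚ) / (a i : ℚ)) -
        1 / ((a ⟨n - 2, by omega⟩ : ℚ) * (a ⟨n - 1, by omega⟩ : ℚ)) := by
  refine hwin.one_le_sum_sub ha ?_ (by simp)
  rw [Ne, Fin.mk.injEq]
  omega
end

section
/- Let n ≥ 3 and let G be the almost complete graph obtained from the complete graph K_n on vertices A_1, …, A_n by removing the edge A_{n−1}A_n, with hatnesses a_1, …, a_n (positive integers). Suppose the Hats game on G is winning and the equality 1/a_1 + 1/a_2 + … + 1/a_n − 1/(a_{n−1}·a_n) = 1 holds (i.e., the game is almost precise). Then the product a_1·a_2⋯a_{n−2} is divisible by a_{n−1}·a_n. -/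
/-- A guesser whose guess ignores its own hat is right on at most a fraction `1 / b v` of the
hat arrangements. -/
theorem mul_card_guess_correct_le {ι : Type*} [Fintype ι] [DecidableEq ι] (b : ι → ℕ) (v : ι)
    (g : ((u : ι) → Fin (b u)) → Fin (b v))
    (hg : ∀ c k, g (Function.update c v k) = g c) :
    b v * (Finset.univ.filter fun c => g c = c v).card ≤ ∏ u, b u := by
  have key : ((Finset.univ.filter fun c => g c = c v) ×ˢ (Finset.univ : Finset (Fin (b v)))).card ≤
      (Finset.univ : Finset ((u : ι) → Fin (b u))).card := by
    refine Finset.card_le_card_of_injOn (fun ck => Function.update ck.1 v ck.2)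
      (fun _ _ => Finset.mem_coe.2 (Finset.mem_univ _)) ?_
    rintro ⟨c, k⟩ hc ⟨d, l⟩ hd h
    simp only [Finset.coe_product, Set.mem_prod, Finset.mem_coe, Finset.mem_filter,
      Finset.mem_univ, true_and, and_true] at hc hd h
    have hv : c v = d v := by rw [← hc, ← hd, ← hg c k, ← hg d l, h]
    have hk : k = l := by simpa using congrFun h v
    have hcd : c = d := by
      funext u
      by_cases hu : u = v
      · subst hu; exact hv
      · simpa [hu] using congrFun h u
    rw [hcd, hk]
  simpa [Finset.card_product, Fintype.card_pi, mul_comm] using key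

/-- If the number of points avoiding both a row and a column never exceeds its average, then
all fibers of the pair `(p, q)` have equal size. -/
theorem mul_dvd_card_of_avoid_le {D : Type*} [Fintype D] {x y : ℕ} (hx : 2 ≤ x) (hy : 2 ≤ y)
    (p : D → Fin x) (q : D → Fin y) (S : ℚ)
    (hS : x * y * S = Fintype.card D * (x - 1) * (y - 1))
    (hle : ∀ i j, ((Finset.univ.filter fun c => p c ≠ i ∧ q c ≠ j).card : ℚ) ≤ S) :
    x * y ∣ Fintype.card D := by
  have hx' : (2 : ℚ) ≤ x := by exact_mod_cast hx
  have hy' : (2 : ℚ) ≤ y := by exact_mod_cast hy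
  set r : Fin x → D → ℚ := fun i c => if p c = i then 1 else 0 with hr
  set s : Fin y → D → ℚ := fun j c => if q c = j then 1 else 0 with hs
  have hrsum : ∀ c, ∑ i, (1 - r i c) = x - 1 := fun c => by simp [hr]
  have hssum : ∀ c, ∑ j, (1 - s j c) = y - 1 := fun c => by simp [hs]
  set K : Fin x → Fin y → ℚ := fun i j => ∑ c, (1 - r i c) * (1 - s j c) with hK
  have hKle : ∀ i j, K i j ≤ S := fun i j => by
    refine le_of_eq_of_le ?_ (hle i j)
    rw [Finset.card_filter, Nat.cast_sum]
    refine Finset.sum_congr rfl fun c _ => ?_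
    by_cases h1 : p c = i <;> by_cases h2 : q c = j <;> simp [hr, hs, h1, h2]
  have hcol : ∀ j, ∑ i, K i j = (x - 1) * ∑ c, (1 - s j c) := fun j => by
    rw [hK, Finset.sum_comm, Finset.mul_sum]
    refine Finset.sum_congr rfl fun c _ => ?_
    rw [← Finset.sum_mul, hrsum]
  have hrow : ∀ i, ∑ j, K i j = (y - 1) * ∑ c, (1 - r i c) := fun i => by
    rw [hK, Finset.sum_comm, Finset.mul_sum]
    refine Finset.sum_congr rfl fun c _ => ?_
    rw [← Finset.mul_sum, hssum, mul_comm]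
  have htot : ∑ ij : Fin x × Fin y, K ij.1 ij.2 = ∑ _ij : Fin x × Fin y, S := by
    rw [Fintype.sum_prod_type_right]
    simp only [hcol]
    rw [← Finset.mul_sum, Finset.sum_comm]
    simp only [hssum, Finset.sum_const, Finset.card_univ, Fintype.card_prod, Fintype.card_fin,
      nsmul_eq_mul, Nat.cast_mul]
    rw [hS]; ring
  have hKeq : ∀ i j, K i j = S := fun i j =>
    (Finset.sum_eq_sum_iff_of_le fun ij _ => hKle ij.1 ij.2).1 htot (i, j) (Finset.mem_univ _)
  let i : Fin x := ⟨0, by omega⟩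
  let j : Fin y := ⟨0, by omega⟩
  have hc := hcol j
  have hr' := hrow i
  simp only [hKeq, Finset.sum_const, Finset.card_univ, Fintype.card_fin, nsmul_eq_mul] at hc hr'
  have hC : y * ∑ c, (1 - s j c) = Fintype.card D * ((y : ℚ) - 1) := by
    apply mul_left_cancel₀ (show (x : ℚ) - 1 ≠ 0 by linarith)
    linear_combination hS - y * hc
  have hR : x * ∑ c, (1 - r i c) = Fintype.card D * ((x : ℚ) - 1) := by
    apply mul_left_cancel₀ (show (y : ℚ) - 1 ≠ 0 by linarith)
    linear_combination hS - x * hr'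
  have hM : ((Finset.univ.filter fun c => p c = i ∧ q c = j).card : ℚ) =
      K i j - ∑ c, (1 - s j c) - ∑ c, (1 - r i c) + Fintype.card D := by
    rw [Finset.card_filter, Nat.cast_sum, ← Finset.card_univ, Finset.card_eq_sum_ones,
      Nat.cast_sum, hK, ← Finset.sum_sub_distrib, ← Finset.sum_sub_distrib,
      ← Finset.sum_add_distrib]
    refine Finset.sum_congr rfl fun c _ => ?_
    by_cases h1 : p c = i <;> by_cases h2 : q c = j <;> simp [hr, hs, h1, h2]
  refine ⟨(Finset.univ.filter fun c => p c = i ∧ q c = j).card, ?_⟩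
  have : (Fintype.card D : ℚ) =
      x * y * ((Finset.univ.filter fun c => p c = i ∧ q c = j).card : ℚ) := by
    rw [hM, hKeq]
    linear_combination x * hC + y * hR - hS
  exact_mod_cast this

/-- An almost precise family of games on a complete graph, indexed by the hats `(i, j)` of two
further guessers `p` and `q` who only see that graph. -/
theorem mul_dvd_prod_of_cover {ι : Type*} [Fintype ι] [DecidableEq ι] [Nonempty ι] (b : ι → ℕ)
    (hb : ∀ v, 0 < b v) {x y : ℕ} (hx : 0 < x) (hy : 0 < y)
    (p : ((u : ι) → Fin (b u)) → Fin x) (q : ((u : ι) → Fin (b u)) → Fin y)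
    (g : Fin x → Fin y → (v : ι) → ((u : ι) → Fin (b u)) → Fin (b v))
    (hg : ∀ i j v c k, g i j v (Function.update c v k) = g i j v c)
    (hcover : ∀ i j c, p c = i ∨ q c = j ∨ ∃ v, g i j v c = c v)
    (heq : (∑ v, (1 : ℚ) / b v) + 1 / x + 1 / y - 1 / (x * y) = 1) :
    x * y ∣ ∏ v, b v := by
  have hx0 : (x : ℚ) ≠ 0 := by positivity
  have hy0 : (y : ℚ) ≠ 0 := by positivity
  have hpos : 0 < ∑ v, (1 : ℚ) / b v :=
    Finset.sum_pos (fun v _ => one_div_pos.2 (Nat.cast_pos.2 (hb v))) Finset.univ_nonempty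
  have hσ : x * y * ∑ v, (1 : ℚ) / b v = (x - 1) * (y - 1) := by
    field_simp at heq ⊢
    linear_combination heq
  have hprod : 0 < ((x : ℚ) - 1) * (y - 1) := by rw [← hσ]; positivity
  have hx2 : 2 ≤ x := by
    by_contra h
    obtain rfl : x = 1 := by omega
    simp at hprod
  have hy2 : 2 ≤ y := by
    by_contra h
    obtain rfl : y = 1 := by omega
    simp at hprod
  have hcard : Fintype.card ((u : ι) → Fin (b u)) = ∏ v, b v := by simp [Fintype.card_pi]
  rw [← hcard]
  refine mul_dvd_card_of_avoid_le hx2 hy2 p q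
    (Fintype.card ((u : ι) → Fin (b u)) * ∑ v, (1 : ℚ) / b v)
    (by linear_combination (Fintype.card ((u : ι) → Fin (b u)) : ℚ) * hσ) fun i j => ?_
  have hsub : (Finset.univ.filter fun c => p c ≠ i ∧ q c ≠ j) ⊆
      Finset.univ.biUnion fun v => Finset.univ.filter fun c => g i j v c = c v := by
    intro c hc
    simp only [Finset.mem_filter, Finset.mem_univ, true_and, Finset.mem_biUnion] at hc ⊢
    exact ((hcover i j c).resolve_left hc.1).resolve_left hc.2
  have hcardle := (Finset.card_le_card hsub).trans Finset.card_biUnion_le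
  refine (Nat.cast_le.2 hcardle).trans ?_
  rw [Nat.cast_sum, Finset.mul_sum]
  refine Finset.sum_le_sum fun v _ => ?_
  have hbv : (0 : ℚ) < b v := Nat.cast_pos.2 (hb v)
  rw [mul_one_div, le_div_iff₀ hbv, hcard, mul_comm]
  exact_mod_cast mul_card_guess_correct_le b v (g i j v) (hg i j v)

/-- In an almost precise game on the almost complete graph `K_n` minus the edge
`A_{n-1} A_n`, the product `a_1 ⋯ a_{n-2}` is divisible by `a_{n-1} · a_n`. -/
theorem almost_precise_divisibility (n : ℕ) (hn : 3 ≤ n) (a : Fin n → ℕ) (ha : ∀ i, 0 < a i)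
    (hwin : HatsWinning
      ((⊤ : SimpleGraph (Fin n)).deleteEdges
        {s((⟨n - 2, by omega⟩ : Fin n), (⟨n - 1, by omega⟩ : Fin n))}) a)
    (heq : (∑ i, (1 : ℚ) / (a i : ℚ)) -
        1 / ((a ⟨n - 2, by omega⟩ : ℚ) * (a ⟨n - 1, by omega⟩ : ℚ)) = 1) :
    (a ⟨n - 2, by omega⟩ * a ⟨n - 1, by omega⟩) ∣
      ∏ i ∈ Finset.univ.filter (fun i : Fin n => (i : ℕ) < n - 2), a i := by
  obtain ⟨m, rfl⟩ : ∃ m, n = m + 1 + 1 := ⟨n - 2, by omega⟩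
  obtain ⟨f, hf, hcov⟩ := hwin
  have hu : (⟨m + 1 + 1 - 2, by omega⟩ : Fin (m + 1 + 1)) = (Fin.last m).castSucc := rfl
  have hw : (⟨m + 1 + 1 - 1, by omega⟩ : Fin (m + 1 + 1)) = Fin.last (m + 1) := rfl
  simp only [hu, hw] at hf heq ⊢
  have hprod : ∏ i ∈ Finset.univ.filter (fun i : Fin (m + 1 + 1) => (i : ℕ) < m + 1 + 1 - 2), a i =
      ∏ k : Fin m, a k.castSucc.castSucc := by
    rw [Finset.prod_filter, Fin.prod_univ_castSucc, Fin.prod_univ_castSucc]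
    simp
  rw [hprod]
  have : Nonempty (Fin m) := ⟨⟨0, by omega⟩⟩
  let ext : ((k : Fin m) → Fin (a k.castSucc.castSucc)) → Fin (a (Fin.last m).castSucc) →
      Fin (a (Fin.last (m + 1))) → (v : Fin (m + 1 + 1)) → Fin (a v) := fun c i j =>
    Fin.snoc (α := fun v => Fin (a v))
      (Fin.snoc (α := fun v : Fin (m + 1) => Fin (a v.castSucc)) c i) j
  have ext_inner : ∀ c i j k, ext c i j (Fin.castSucc (Fin.castSucc k)) = c k := fun c i j k => by
    simp [ext]
  have ext_u : ∀ c i j, ext c i j (Fin.last m).castSucc = i := fun c i j => by simp [ext]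
  have ext_w : ∀ c i j, ext c i j (Fin.last (m + 1)) = j := fun c i j => by simp [ext]
  let i₀ : Fin (a (Fin.last m).castSucc) := ⟨0, ha _⟩
  let j₀ : Fin (a (Fin.last (m + 1))) := ⟨0, ha _⟩
  refine mul_dvd_prod_of_cover (fun k : Fin m => a k.castSucc.castSucc) (fun k => ha _)
    (ha _) (ha _) (fun c => f _ (ext c i₀ j₀)) (fun c => f _ (ext c i₀ j₀))
    (fun i j k c => f _ (ext c i j)) ?_ ?_ ?_
  · intro i j k c l
    refine hf _ _ _ fun v hv => ?_
    induction v using Fin.lastCases with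
    | last => rw [ext_w, ext_w]
    | cast v =>
      induction v using Fin.lastCases with
      | last => rw [ext_u, ext_u]
      | cast v =>
        rw [ext_inner, ext_inner]
        have hne : v ≠ k := by
          rintro rfl
          exact hv.ne rfl
        simp [hne]
  · intro i j c
    obtain ⟨v, hv⟩ := hcov (ext c i j)
    induction v using Fin.lastCases with
    | last =>
      right; left
      rw [ext_w] at hv
      rw [← hv]
      refine hf _ _ _ fun v hadj => ?_
      induction v using Fin.lastCases with
      | last => exact absurd rfl hadj.ne
      | cast v =>
        induction v using Fin.lastCases with
        | last => simp [SimpleGraph.deleteEdges_adj, Sym2.eq_swap] at hadj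
        | cast v => rw [ext_inner, ext_inner]
    | cast v =>
      induction v using Fin.lastCases with
      | last =>
        left
        rw [ext_u] at hv
        rw [← hv]
        refine hf _ _ _ fun v hadj => ?_
        induction v using Fin.lastCases with
        | last => simp [SimpleGraph.deleteEdges_adj] at hadj
        | cast v =>
          induction v using Fin.lastCases with
          | last => exact absurd rfl hadj.ne
          | cast v => rw [ext_inner, ext_inner]
      | cast v =>
        right; right
        rw [ext_inner] at hv
        exact ⟨v, hv⟩
  · rw [Fin.sum_univ_castSucc, Fin.sum_univ_castSucc] at heq
    exact heq
end

section
/- Let n ≥ 4 and let G be the almost complete graph obtained from the complete graph K_n on vertices A_1, …, A_n by removing the edge A_{n−1}A_n, with hatnesses a_1, …, a_n (positive integers) satisfying 1/a_1 + 1/a_2 + … + 1/a_n − 1/(a_{n−1}·a_n) = 1. If a_1 = 2, then the Hats game on G is losing. -/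
open Function in
/-- In a game on a graph with nonadjacent vertices `b ≠ c` and a third vertex `p` of hatness `2`,
the sages lose as soon as the union bound, corrected by the independence of `b` and `c`, is at
most `1`. -/
theorem not_hatsWinning_of_hatness_two {V : Type*} [Fintype V] [DecidableEq V]
    (G : SimpleGraph V) (h : V → ℕ) (hpos : ∀ v, 0 < h v) {p b c : V}
    (hpb : p ≠ b) (hpc : p ≠ c) (hbc : b ≠ c) (hadj : ¬ G.Adj b c)
    (hsum : (∑ v, (1 : ℚ) / (h v : ℚ)) - 1 / ((h b : ℚ) * (h c : ℚ)) ≤ 1)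
    (hp : h p = 2) : ¬ HatsWinning G h := by
  rintro ⟨f, hf, hwin⟩
  have hupd : ∀ (v u : V) (φ : (u : V) → Fin (h u)) (x : Fin (h u)), ¬ G.Adj v u →
      f v (update φ u x) = f v φ := by
    intro v u φ x huv
    refine hf v _ _ fun w hw => update_of_ne ?_ _ _
    rintro rfl
    exact huv hw
  have hadj' : ¬ G.Adj c b := fun h' => hadj h'.symm
  have hself : ∀ v (φ : (u : V) → Fin (h u)) x, f v (update φ v x) = f v φ :=
    fun v φ x => hupd v v φ x (G.loopless.irrefl v)
  have hhq : ∀ v, (h v : ℚ) ≠ 0 := fun v => by exact_mod_cast (hpos v).ne'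
  let Φ := (u : V) → Fin (h u)
  have hcard : ∀ v, Fintype.card {φ : Φ // f v φ = φ v} * h v = Fintype.card Φ := by
    intro v
    let e : {φ : Φ // f v φ = φ v} × Fin (h v) ≃ Φ :=
      { toFun := fun x => update x.1.1 v x.2
        invFun := fun ψ => (⟨update ψ v (f v ψ), by simp [hself]⟩, ψ v)
        left_inv := by
          rintro ⟨⟨φ, hφ⟩, x⟩
          simp [hself, hφ]
        right_inv := fun ψ => by simp }
    simpa using Fintype.card_congr e
  have hcard2 : Fintype.card {φ : Φ // f b φ = φ b ∧ f c φ = φ c} * (h b * h c)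
      = Fintype.card Φ := by
    let e : {φ : Φ // f b φ = φ b ∧ f c φ = φ c} × (Fin (h b) × Fin (h c)) ≃ Φ :=
      { toFun := fun x => update (update x.1.1 b x.2.1) c x.2.2
        invFun := fun ψ => (⟨update (update ψ b (f b ψ)) c (f c ψ), by
          simp [hself, hupd _ _ _ _ hadj, hupd _ _ _ _ hadj', update_of_ne hbc]⟩, ψ b, ψ c)
        left_inv := by
          rintro ⟨⟨φ, hφ, hφ'⟩, x, y⟩
          simp [hself, hupd _ _ _ _ hadj, hupd _ _ _ _ hadj', hφ, hφ', update_of_ne hbc,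
            update_comm hbc]
        right_inv := fun ψ => by simp [update_comm hbc] }
    simpa using Fintype.card_congr e
  obtain ⟨φ₀, hφp, hφbc⟩ : ∃ φ : Φ, f p φ = φ p ∧ (f b φ = φ b ∨ f c φ = φ c) := by
    let ψ : Φ := fun u => ⟨0, hpos u⟩
    let s : Fin (h p) := ⟨0, by omega⟩
    let t : Fin (h p) := ⟨1, by omega⟩
    let χ : Fin (h p) → Φ := fun x =>
      update (update (update ψ b (f b (update ψ p s))) c (f c (update ψ p t))) p x
    have hst : f p (χ s) = s ∨ f p (χ s) = t := by
      have := (f p (χ s)).2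
      simp only [Fin.ext_iff, s, t]
      omega
    have hχ : ∀ x, f p (χ x) = f p (χ s) := fun x => by simp only [χ, hself]
    have hχ' : ∀ x, χ x =
        update (update (update ψ p x) b (f b (update ψ p s))) c (f c (update ψ p t)) := by
      intro x
      simp only [χ]
      rw [update_comm hpc.symm, update_comm hpb.symm]
    rcases hst with h1 | h1
    · refine ⟨χ s, by rw [h1]; simp [χ], Or.inl ?_⟩
      rw [hχ', hupd _ _ _ _ hadj, hself, update_of_ne hbc, update_self]
    · refine ⟨χ t, by rw [hχ, h1]; simp [χ], Or.inr ?_⟩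
      rw [hχ', hself, hupd _ _ _ _ hadj', update_self]
  let k : Φ → ℕ := fun φ => (Finset.univ.filter fun v => f v φ = φ v).card
  have hle : ∀ φ : Φ, 1 + (if f b φ = φ b ∧ f c φ = φ c then 1 else 0) ≤ k φ := by
    intro φ
    split_ifs with hφ
    · exact Finset.one_lt_card.2 ⟨b, by simp [hφ], c, by simp [hφ], hbc⟩
    · obtain ⟨v, hv⟩ := hwin φ
      exact Finset.card_pos.2 ⟨v, by simp [hv]⟩
  have hlt : 1 + (if f b φ₀ = φ₀ b ∧ f c φ₀ = φ₀ c then 1 else 0) < k φ₀ := by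
    split_ifs with hφ
    · have : ({p, b, c} : Finset V).card = 3 := by
        rw [Finset.card_eq_three]
        exact ⟨p, b, c, hpb, hpc, hbc, rfl⟩
      refine lt_of_lt_of_le (by omega : 1 + 1 < ({p, b, c} : Finset V).card) ?_
      refine Finset.card_le_card fun v hv => ?_
      simp only [Finset.mem_insert, Finset.mem_singleton] at hv
      rcases hv with rfl | rfl | rfl <;> simp [hφ, hφp]
    · refine Finset.one_lt_card.2 ?_
      rcases hφbc with hb | hc
      · exact ⟨p, by simp [hφp], b, by simp [hb], hpb⟩
      · exact ⟨p, by simp [hφp], c, by simp [hc], hpc⟩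
  have hstrict := Finset.sum_lt_sum (fun φ _ => hle φ) ⟨φ₀, Finset.mem_univ _, hlt⟩
  have hk : ∑ φ, k φ = ∑ v, Fintype.card {φ : Φ // f v φ = φ v} := by
    simp only [k, Finset.card_filter, Fintype.card_subtype]
    exact Finset.sum_comm
  rw [hk, Finset.sum_add_distrib, ← Finset.card_filter, ← Fintype.card_subtype] at hstrict
  simp only [Finset.sum_const, Finset.card_univ, smul_eq_mul, mul_one] at hstrict
  set N : ℚ := (Fintype.card Φ : ℚ) with hN
  have hc1 : ∀ v, (Fintype.card {φ : Φ // f v φ = φ v} : ℚ) = N * (1 / (h v : ℚ)) := by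
    intro v
    rw [mul_one_div, eq_div_iff (hhq v), hN]
    exact_mod_cast hcard v
  have hc2 : (Fintype.card {φ : Φ // f b φ = φ b ∧ f c φ = φ c} : ℚ)
      = N * (1 / ((h b : ℚ) * (h c : ℚ))) := by
    rw [mul_one_div, eq_div_iff (mul_ne_zero (hhq b) (hhq c)), hN]
    exact_mod_cast hcard2
  have hq : N + (Fintype.card {φ : Φ // f b φ = φ b ∧ f c φ = φ c} : ℚ)
      < ∑ v, (Fintype.card {φ : Φ // f v φ = φ v} : ℚ) := by
    rw [hN]
    exact_mod_cast hstrict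
  rw [hc2, Finset.sum_congr rfl fun v _ => hc1 v, ← Finset.mul_sum] at hq
  have hN0 : 0 ≤ N := Nat.cast_nonneg _
  nlinarith [mul_le_mul_of_nonneg_left hsum hN0]


/-- On the almost complete graph `K_n` minus the edge `A_{n-1} A_n` with hat function
satisfying the almost precise equality, if `a_1 = 2` then the sages lose. -/
theorem almost_clique_a1_eq_two_losing (n : ℕ) (hn : 4 ≤ n) (a : Fin n → ℕ)
    (ha : ∀ i, 0 < a i)
    (heq : (∑ i, (1 : ℚ) / (a i : ℚ)) -
        1 / ((a ⟨n - 2, by omega⟩ : ℚ) * (a ⟨n - 1, by omega⟩ : ℚ)) = 1)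
    (ha1 : a ⟨0, by omega⟩ = 2) :
    ¬ HatsWinning
      ((⊤ : SimpleGraph (Fin n)).deleteEdges
        {s((⟨n - 2, by omega⟩ : Fin n), (⟨n - 1, by omega⟩ : Fin n))}) a := by
  refine not_hatsWinning_of_hatness_two _ a ha (p := ⟨0, by omega⟩) (b := ⟨n - 2, by omega⟩)
    (c := ⟨n - 1, by omega⟩) ?_ ?_ ?_ ?_ heq.le ha1
  · simp only [ne_eq, Fin.mk.injEq]; omega
  · simp only [ne_eq, Fin.mk.injEq]; omega
  · simp only [ne_eq, Fin.mk.injEq]; omega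
  · simp
end

section
/- Let n ≥ 4 and let G be the almost complete graph obtained from the complete graph K_n on vertices A_1, …, A_n by removing the edge A_{n−1}A_n, with hatnesses a_1, …, a_n (positive integers) satisfying 1/a_1 + 1/a_2 + … + 1/a_n − 1/(a_{n−1}·a_n) = 1. If a_1 = 3 and a_n = 2, then the Hats game on G is losing. -/
/-- If the guess of `v` ignores the hat of `v`, and membership in `S` ignores it too, then `v`
guesses correctly on a fraction `1 / h v` of `S`. -/
lemma card_mul_card_filter_guess {V : Type*} [Fintype V] [DecidableEq V] (h : V → ℕ) (v : V)
    (g : ((u : V) → Fin (h u)) → Fin (h v)) (hg : ∀ φ c, g (Function.update φ v c) = g φ)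
    (S : Finset ((u : V) → Fin (h u))) (hS : ∀ φ c, φ ∈ S → Function.update φ v c ∈ S) :
    (S.filter fun φ => g φ = φ v).card * h v = S.card := by
  have key : ((S.filter fun φ => g φ = φ v) ×ˢ (Finset.univ : Finset (Fin (h v)))).card
      = S.card := by
    refine Finset.card_nbij' (fun p => Function.update p.1 v p.2)
      (fun ψ => (Function.update ψ v (g ψ), ψ v)) ?_ ?_ ?_ ?_
    · rintro ⟨φ, c⟩ hp
      simp only [Finset.coe_product, Finset.coe_univ, Set.mem_prod, Finset.mem_coe,
        Finset.mem_filter] at hp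
      exact hS φ c hp.1.1
    · intro ψ hψ
      simp [hg, hS ψ _ hψ]
    · rintro ⟨φ, c⟩ hp
      simp only [Finset.coe_product, Finset.coe_univ, Set.mem_prod, Finset.mem_coe,
        Finset.mem_filter] at hp
      simp [hg, hp.1.2]
    · intro ψ _
      simp
  simpa using key

/-- Three elements labelled in `Y` and two-coloured in `Z`: some label and colour
together hit every element. -/
lemma exists_label_color_hitting {X Y Z : Type*} [Fintype X] [Fintype Z] [DecidableEq Z]
    (hX : Fintype.card X = 3) (hZ : Fintype.card Z = 2) (k : X → Y) (g : X → Z) :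
    ∃ y z, ∀ x, k x = y ∨ g x = z := by
  classical
  have : Nonempty X := Fintype.card_pos_iff.mp (by omega)
  obtain ⟨z, hz⟩ := Fintype.exists_card_fiber_lt_of_card_lt_mul g (n := 2) (by omega)
  obtain ⟨x₀, hx₀⟩ := Finset.card_le_one_iff_subset_singleton.mp (Nat.le_of_lt_succ hz)
  have : Nontrivial Z := Fintype.one_lt_card_iff_nontrivial.mp (by omega)
  obtain ⟨w, hw⟩ := exists_ne z
  refine ⟨k x₀, w, fun x => ?_⟩
  by_cases hx : g x = z
  · left
    rw [Finset.mem_singleton.mp (hx₀ (Finset.mem_filter.mpr ⟨Finset.mem_univ x, hx⟩))]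
  · right
    by_contra hxw
    have h3 : ({z, w, g x} : Finset Z).card = 3 :=
      Finset.card_eq_three.mpr ⟨z, w, g x, hw.symm, Ne.symm hx, Ne.symm hxw, rfl⟩
    have := Finset.card_le_univ ({z, w, g x} : Finset Z)
    omega

/-- In a winning strategy satisfying the almost precise equality for non-adjacent `p` and `q`,
no other vertex `r` guesses correctly together with `p` or `q`. -/
lemma not_guess_and_guess_of_almost_precise {V : Type*} [Fintype V] [DecidableEq V] (h : V → ℕ)
    (hpos : ∀ v, 0 < h v) (f : (v : V) → ((u : V) → Fin (h u)) → Fin (h v))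
    (hself : ∀ v φ c, f v (Function.update φ v c) = f v φ) {p q r : V}
    (hpq : p ≠ q) (hrp : r ≠ p) (hrq : r ≠ q)
    (hfq : ∀ φ c, f q (Function.update φ p c) = f q φ)
    (heq : (∑ v, (1 : ℚ) / h v) - 1 / ((h p : ℚ) * h q) = 1)
    (hwin : ∀ φ, ∃ v, f v φ = φ v) (φ : (u : V) → Fin (h u)) (hr : f r φ = φ r) :
    f p φ ≠ φ p ∧ f q φ ≠ φ q := by
  obtain ⟨N, hN⟩ : ∃ N : ℚ, N = Fintype.card ((u : V) → Fin (h u)) := ⟨_, rfl⟩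
  let I : V → ((u : V) → Fin (h u)) → ℚ := fun v ψ => if f v ψ = ψ v then 1 else 0
  have hI0 : ∀ v ψ, 0 ≤ I v ψ := fun v ψ => by simp only [I]; split_ifs <;> norm_num
  have hI1 : ∀ v ψ, f v ψ = ψ v → I v ψ = 1 := fun v ψ hv => if_pos hv
  have hIz : ∀ v ψ, f v ψ ≠ ψ v → I v ψ = 0 := fun v ψ hv => if_neg hv
  have hpos' : ∀ v, (h v : ℚ) ≠ 0 := fun v => by exact_mod_cast (hpos v).ne'
  have hsum : ∀ v, ∑ ψ, I v ψ = N * (1 / h v) := by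
    intro v
    have := card_mul_card_filter_guess h v (f v) (hself v) Finset.univ (by simp)
    rw [mul_one_div, eq_div_iff (hpos' v), Finset.sum_boole, hN, ← Finset.card_univ]
    exact_mod_cast this
  have hsum2 : ∑ ψ, I p ψ * I q ψ = N * (1 / ((h p : ℚ) * h q)) := by
    have := card_mul_card_filter_guess h p (f p) (hself p)
      (Finset.univ.filter fun ψ => f q ψ = ψ q) (by
        intro ψ c hψ
        simpa [hfq, Function.update_of_ne hpq.symm] using hψ)
    have hq := hsum q
    have hmul : ∀ ψ, I p ψ * I q ψ = if f q ψ = ψ q ∧ f p ψ = ψ p then 1 else 0 := by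
      intro ψ
      simp only [I]
      split_ifs <;> simp_all
    simp only [I, Finset.sum_boole] at hq
    rw [Finset.filter_filter] at this
    simp only [hmul, Finset.sum_boole]
    rw [mul_one_div, mul_comm (h p : ℚ), ← div_div, eq_div_iff (hpos' p), ← mul_one_div, ← hq]
    exact_mod_cast this
  have hsplit : ∀ ψ, ∑ v, I v ψ
      = I p ψ + (I q ψ + ∑ v ∈ (Finset.univ.erase p).erase q, I v ψ) := by
    intro ψ
    rw [Finset.add_sum_erase _ (fun v => I v ψ) (by simp [hpq.symm]),
      Finset.add_sum_erase _ (fun v => I v ψ) (by simp)]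
  have hrest : ∀ v ψ, v ≠ p → v ≠ q → f v ψ = ψ v →
      1 ≤ ∑ v ∈ (Finset.univ.erase p).erase q, I v ψ := by
    intro v ψ hvp hvq hv
    have := Finset.single_le_sum (f := fun v => I v ψ) (fun v _ => hI0 v ψ)
      (show v ∈ (Finset.univ.erase p).erase q by simp [hvp, hvq])
    simpa [I, hv] using this
  have hrest0 : ∀ ψ, 0 ≤ ∑ v ∈ (Finset.univ.erase p).erase q, I v ψ :=
    fun ψ => Finset.sum_nonneg fun v _ => hI0 v ψ
  have hge : ∀ ψ ∈ Finset.univ, (1 : ℚ) ≤ ∑ v, I v ψ - I p ψ * I q ψ := by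
    intro ψ _
    rw [hsplit]
    have h0 := hrest0 ψ
    obtain ⟨v, hv⟩ := hwin ψ
    by_cases hp : f p ψ = ψ p
    · rw [hI1 p ψ hp]
      linarith
    by_cases hq : f q ψ = ψ q
    · rw [hI1 q ψ hq]
      linarith
    have h1 := hrest v ψ (by rintro rfl; exact hp hv) (by rintro rfl; exact hq hv) hv
    rw [hIz p ψ hp, hIz q ψ hq]
    linarith
  have htotal : ∑ ψ : (u : V) → Fin (h u), (1 : ℚ)
      = ∑ ψ, (∑ v, I v ψ - I p ψ * I q ψ) := by
    rw [Finset.sum_sub_distrib, Finset.sum_comm, hsum2, Finset.sum_congr rfl fun v _ => hsum v,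
      ← Finset.mul_sum, ← mul_sub, heq]
    simp [hN]
  have hφ := (Finset.sum_eq_sum_iff_of_le hge).mp htotal φ (Finset.mem_univ φ)
  rw [hsplit] at hφ
  have h1 := hrest r φ hrp hrq hr
  constructor
  · intro hp
    rw [hI1 p φ hp] at hφ
    linarith
  · intro hq
    rw [hI1 q φ hq] at hφ
    linarith

/-- On the almost complete graph `K_n` minus the edge `A_{n-1} A_n` with hat function
satisfying the almost precise equality, if `a_1 = 3` and `a_n = 2` then the sages lose. -/
theorem almost_clique_a1_three_an_two_losing (n : ℕ) (hn : 4 ≤ n) (a : Fin n → ℕ)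
    (ha : ∀ i, 0 < a i)
    (heq : (∑ i, (1 : ℚ) / (a i : ℚ)) -
        1 / ((a ⟨n - 2, by omega⟩ : ℚ) * (a ⟨n - 1, by omega⟩ : ℚ)) = 1)
    (ha1 : a ⟨0, by omega⟩ = 3) (han : a ⟨n - 1, by omega⟩ = 2) :
    ¬ HatsWinning
      ((⊤ : SimpleGraph (Fin n)).deleteEdges
        {s((⟨n - 2, by omega⟩ : Fin n), (⟨n - 1, by omega⟩ : Fin n))}) a := by
  rintro ⟨f, hloc, hwin⟩
  set r : Fin n := ⟨0, by omega⟩ with hr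
  set p : Fin n := ⟨n - 2, by omega⟩ with hp
  set q : Fin n := ⟨n - 1, by omega⟩ with hq
  have hpq : p ≠ q := by simp only [hp, hq, ne_eq, Fin.mk.injEq]; omega
  have hrp : r ≠ p := by simp only [hr, hp, ne_eq, Fin.mk.injEq]; omega
  have hrq : r ≠ q := by simp only [hr, hq, ne_eq, Fin.mk.injEq]; omega
  have hupd : ∀ v w, ¬ ((⊤ : SimpleGraph (Fin n)).deleteEdges {s(p, q)}).Adj v w →
      ∀ φ c, f v (Function.update φ w c) = f v φ := by
    intro v w hvw φ c
    refine hloc v _ _ fun u hu => Function.update_of_ne ?_ _ _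
    rintro rfl
    exact hvw hu
  have hself : ∀ v φ c, f v (Function.update φ v c) = f v φ := fun v => hupd v v (by simp)
  have hfq := hupd q p (by simp [Sym2.eq_swap])
  have hfp := hupd p q (by simp)
  have hdisj := not_guess_and_guess_of_almost_precise a ha f hself hpq hrp hrq hfq heq hwin
  let φ₀ : (u : Fin n) → Fin (a u) := fun u => ⟨0, ha u⟩
  obtain ⟨β, γ, hβγ⟩ := exists_label_color_hitting (X := Fin (a r)) (Z := Fin (a q))
    (by simpa using ha1) (by simpa using han)
    (fun i => f p (Function.update φ₀ r i)) (fun i => f q (Function.update φ₀ r i))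
  set ψ := Function.update (Function.update φ₀ p β) q γ with hψ
  set i := f r ψ with hi
  obtain ⟨h1, h2⟩ := hdisj (Function.update ψ r i) (by rw [hself, Function.update_self])
  have hcomm : Function.update ψ r i
      = Function.update (Function.update (Function.update φ₀ r i) p β) q γ := by
    rw [hψ, Function.update_comm hrq.symm, Function.update_comm hrp.symm]
  rw [hcomm, hfp, hself, Function.update_of_ne hpq, Function.update_self] at h1
  rw [hcomm, hself, hfq, Function.update_self] at h2
  exact (hβγ i).elim h1 h2
end

section
/- Let G_1 and G_2 be finite simple graphs whose vertex sets intersect in exactly one vertex A, and let ⟨G_1, h_1⟩ and ⟨G_2, h_2⟩ be winning Hats games. Let G be the graph on the union of the two vertex sets whose edge set is the union of the edge sets of G_1 and G_2, and define h by h(v) = h_1(v) for v ∈ V(G_1)∖{A}, h(v) = h_2(v) for v ∈ V(G_2)∖{A}, and h(A) = h_1(A)·h_2(A). Then the Hats game ⟨G, h⟩ is winning. -/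
/-- Product constructor: gluing two winning games at a common vertex `A` and
multiplying the hatnesses at `A` yields a winning game. -/
theorem product_of_games {W : Type*} [Fintype W] (A : W) (V₁ V₂ : Set W)
    (hA₁ : A ∈ V₁) (hA₂ : A ∈ V₂)
    (hcap : V₁ ∩ V₂ = {A}) (hcup : V₁ ∪ V₂ = Set.univ)
    (G₁ : SimpleGraph V₁) (G₂ : SimpleGraph V₂)
    (h₁ : V₁ → ℕ) (h₂ : V₂ → ℕ)
    (hp₁ : ∀ v, 0 < h₁ v) (hp₂ : ∀ v, 0 < h₂ v)
    (hw₁ : HatsWinning G₁ h₁) (hw₂ : HatsWinning G₂ h₂)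
    (G : SimpleGraph W)
    (hG : ∀ u v : W, G.Adj u v ↔
      (∃ (hu : u ∈ V₁) (hv : v ∈ V₁), G₁.Adj ⟨u, hu⟩ ⟨v, hv⟩) ∨
      (∃ (hu : u ∈ V₂) (hv : v ∈ V₂), G₂.Adj ⟨u, hu⟩ ⟨v, hv⟩))
    (h : W → ℕ)
    (hh₁ : ∀ (w : W) (hw : w ∈ V₁), w ≠ A → h w = h₁ ⟨w, hw⟩)
    (hh₂ : ∀ (w : W) (hw : w ∈ V₂), w ≠ A → h w = h₂ ⟨w, hw⟩)
    (hhA : h A = h₁ ⟨A, hA₁⟩ * h₂ ⟨A, hA₂⟩) :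
    HatsWinning G h := by
  obtain ⟨f₁, hloc₁, hwin₁⟩ := hw₁
  obtain ⟨f₂, hloc₂, hwin₂⟩ := hw₂
  have eq_A : ∀ w, w ∈ V₁ → w ∈ V₂ → w = A := fun w hw hw' => by
    have hmem : w ∈ V₁ ∩ V₂ := ⟨hw, hw'⟩
    simpa [hcap] using hmem
  -- Each color at `w` splits into its colors in the two games, from which it is recovered.
  have split : ∀ w : W, ∃ (π₁ : (hw : w ∈ V₁) → Fin (h w) → Fin (h₁ ⟨w, hw⟩))
      (π₂ : (hw : w ∈ V₂) → Fin (h w) → Fin (h₂ ⟨w, hw⟩))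
      (g : ((hw : w ∈ V₁) → Fin (h₁ ⟨w, hw⟩)) → ((hw : w ∈ V₂) → Fin (h₂ ⟨w, hw⟩)) →
        Fin (h w)),
      ∀ c, g (fun hw => π₁ hw c) (fun hw => π₂ hw c) = c := by
    intro w
    by_cases hwA : w = A
    · subst hwA
      let e := (finCongr hhA).trans finProdFinEquiv.symm
      exact ⟨fun _ c => (e c).1, fun _ c => (e c).2, fun x₁ x₂ => e.symm (x₁ hA₁, x₂ hA₂),
        fun c => e.symm_apply_apply c⟩
    · have hw : w ∈ V₁ ∪ V₂ := hcup ▸ Set.mem_univ w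
      rcases hw with hw | hw
      · exact ⟨fun hw => Fin.cast (hh₁ w hw hwA), fun hw' => absurd (eq_A w hw hw') hwA,
          fun x₁ _ => Fin.cast (hh₁ w hw hwA).symm (x₁ hw), fun _ => rfl⟩
      · exact ⟨fun hw' => absurd (eq_A w hw' hw) hwA, fun hw => Fin.cast (hh₂ w hw hwA),
          fun _ x₂ => Fin.cast (hh₂ w hw hwA).symm (x₂ hw), fun _ => rfl⟩
  choose π₁ π₂ g hg using split
  let p₁ (φ : (u : W) → Fin (h u)) (u : V₁) : Fin (h₁ u) := π₁ u.1 u.2 (φ u)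
  let p₂ (φ : (u : W) → Fin (h u)) (u : V₂) : Fin (h₂ u) := π₂ u.1 u.2 (φ u)
  refine ⟨fun w φ => g w (fun hw => f₁ ⟨w, hw⟩ (p₁ φ)) (fun hw => f₂ ⟨w, hw⟩ (p₂ φ)),
    fun w φ ψ hφψ => ?_, fun φ => ?_⟩
  · have e₁ : (fun hw => f₁ ⟨w, hw⟩ (p₁ φ)) = fun hw => f₁ ⟨w, hw⟩ (p₁ ψ) :=
      funext fun hw => hloc₁ _ _ _ fun u hu =>
        congrArg (π₁ u.1 u.2) (hφψ u ((hG _ _).2 (Or.inl ⟨hw, u.2, hu⟩)))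
    have e₂ : (fun hw => f₂ ⟨w, hw⟩ (p₂ φ)) = fun hw => f₂ ⟨w, hw⟩ (p₂ ψ) :=
      funext fun hw => hloc₂ _ _ _ fun u hu =>
        congrArg (π₂ u.1 u.2) (hφψ u ((hG _ _).2 (Or.inr ⟨hw, u.2, hu⟩)))
    simp only [e₁, e₂]
  · have correct : ∀ w, (∀ hw, f₁ ⟨w, hw⟩ (p₁ φ) = p₁ φ ⟨w, hw⟩) →
        (∀ hw, f₂ ⟨w, hw⟩ (p₂ φ) = p₂ φ ⟨w, hw⟩) →
        g w (fun hw => f₁ ⟨w, hw⟩ (p₁ φ)) (fun hw => f₂ ⟨w, hw⟩ (p₂ φ)) = φ w := by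
      intro w hc₁ hc₂
      rw [funext hc₁, funext hc₂]
      exact hg w (φ w)
    obtain ⟨⟨v₁, hv₁⟩, hc₁⟩ := hwin₁ (p₁ φ)
    obtain ⟨⟨v₂, hv₂⟩, hc₂⟩ := hwin₂ (p₂ φ)
    by_cases hA : v₁ = A
    · by_cases hA' : v₂ = A
      · subst hA hA'
        exact ⟨_, correct _ (fun _ => hc₁) (fun _ => hc₂)⟩
      · exact ⟨v₂, correct v₂ (fun hw => absurd (eq_A v₂ hw hv₂) hA') (fun _ => hc₂)⟩
    · exact ⟨v₁, correct v₁ (fun _ => hc₁) (fun hw => absurd (eq_A v₁ hv₁ hw) hA)⟩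
end

section
/- Let G be a finite tree (a connected acyclic simple graph). Then the Hats game ⟨G, h⟩ with hat function h(v) = 2^{deg(v)}, where deg(v) is the degree of vertex v in G, is winning. -/
/-- Give each vertex one bit per incident edge. If on every edge at most one endpoint fails to
guess its own bit, and there are fewer edges than vertices, some vertex guesses all of its bits. -/
theorem exists_forall_adj_of_edge_card_lt {V : Type*} [Fintype V] (G : SimpleGraph V)
    [Fintype G.edgeSet] (hcard : G.edgeFinset.card < Fintype.card V) (right : V → V → Prop)
    (hright : ∀ v u, G.Adj v u → right v u ∨ right u v) :
    ∃ v, ∀ u, G.Adj v u → right v u := by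
  by_contra! hwrong
  choose g hadj hg using hwrong
  obtain ⟨v, -, w, -, hvw, heq⟩ := Finset.exists_ne_map_eq_of_card_lt_of_maps_to
    (s := Finset.univ) (t := G.edgeFinset) (by simpa using hcard) (f := fun v => s(v, g v))
    (by intro v _; simpa using hadj v)
  rcases Sym2.eq_iff.mp heq with ⟨h, -⟩ | ⟨h₁, h₂⟩
  · exact hvw h
  · have hv := hg v
    have hw := hg w
    rw [h₂] at hv
    rw [← h₁] at hw
    exact (hright v w (h₂ ▸ hadj v)).elim hv hw

/-- On a finite tree the sages win with hat function `v ↦ 2 ^ deg v`. -/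
theorem tree_pow_two_degree_winning {V : Type*} [Fintype V] (G : SimpleGraph V)
    [DecidableRel G.Adj] (ht : G.IsTree) :
    HatsWinning G (fun v => 2 ^ G.degree v) := by
  classical
  have hequiv : ∀ v, Nonempty (Fin (2 ^ G.degree v) ≃ (G.neighborSet v → Bool)) := fun v =>
    Fintype.card_eq.mp (by simp [← G.card_neighborSet_eq_degree])
  let bits := fun v => (hequiv v).some
  let e := Fintype.equivFin V
  let guess : ∀ v : V, (∀ u : V, Fin (2 ^ G.degree u)) → G.neighborSet v → Bool :=
    fun v φ u => xor (decide (e v < e u)) (bits u (φ u) ⟨v, G.adj_symm u.2⟩)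
  refine ⟨fun v φ => (bits v).symm (guess v φ), ?_, ?_⟩
  · intro v φ ψ h
    have hguess : guess v φ = guess v ψ := by
      funext u
      simp only [guess, h u u.2]
    simp only [hguess]
  · intro φ
    have hcard : G.edgeFinset.card < Fintype.card V := by
      have := ht.card_edgeFinset
      omega
    obtain ⟨v, hv⟩ := exists_forall_adj_of_edge_card_lt G hcard
      (fun v u => ∀ h : G.Adj v u, guess v φ ⟨u, h⟩ = bits v (φ v) ⟨u, h⟩) (by
        intro v u h
        have hne : e v ≠ e u := e.injective.ne h.ne
        by_contra! hcon
        obtain ⟨⟨h₁, hv⟩, h₂, hu⟩ := hcon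
        simp only [guess] at hv hu
        generalize bits v (φ v) ⟨u, h₁⟩ = a at hv hu
        generalize bits u (φ u) ⟨v, h₂⟩ = b at hv hu
        rcases lt_or_gt_of_ne hne with hlt | hlt <;>
          simp [hlt, hlt.not_gt] at hv hu <;> simp_all)
    refine ⟨v, (Equiv.symm_apply_eq _).mpr (funext fun u => hv u u.2 u.2)⟩
end

section
/- Let n ≥ 2 and let P_n be the path graph on n vertices with endpoint vertices A and B. Then the Hats game on P_n with hat function h given by h(A) = h(B) = 2 and h(v) = 4 for every internal vertex v is winning. -/
/-- The bit of the color `c` that vertex `i` of the path `P_n` shares with vertex `i - 1`. -/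
def leftBit (n i c : ℕ) : ℕ := (if i = n - 1 then c else c / 2) % 2

/-- The guess of vertex `i` on the path `P_n` in the arrangement `c`: the two ends of each edge
play the winning game on two vertices with two colors each, the earlier end guessing that the
bits on the edge agree and the later end guessing that they differ. -/
def pathGuess (n : ℕ) (c : ℕ → ℕ) (i : ℕ) : ℕ :=
  if i = 0 then leftBit n 1 (c 1)
  else if i = n - 1 then 1 - c (i - 1) % 2
  else 2 * (1 - c (i - 1) % 2) + leftBit n (i + 1) (c (i + 1))

theorem leftBit_lt_two (n i c : ℕ) : leftBit n i c < 2 := Nat.mod_lt _ two_pos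

theorem pathGuess_lt (n : ℕ) (c : ℕ → ℕ) (i : ℕ) :
    pathGuess n c i < if i = 0 ∨ i = n - 1 then 2 else 4 := by
  have h₁ := leftBit_lt_two n 1 (c 1)
  have h₂ := leftBit_lt_two n (i + 1) (c (i + 1))
  unfold pathGuess
  split_ifs <;> omega

theorem pathGuess_congr {n : ℕ} (hn : 2 ≤ n) {c d : ℕ → ℕ} {i : ℕ} (hi : i < n)
    (h : ∀ j < n, i + 1 = j ∨ j + 1 = i → c j = d j) : pathGuess n c i = pathGuess n d i := by
  unfold pathGuess
  split_ifs with h₀ h₁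
  · rw [h 1 (by omega) (by omega)]
  · rw [h (i - 1) (by omega) (by omega)]
  · rw [h (i - 1) (by omega) (by omega), h (i + 1) (by omega) (by omega)]

theorem exists_pathGuess_eq {n : ℕ} (hn : 2 ≤ n) {c : ℕ → ℕ}
    (hc : ∀ i < n, c i < if i = 0 ∨ i = n - 1 then 2 else 4) :
    ∃ i < n, pathGuess n c i = c i := by
  by_contra! H
  have key : ∀ i, i + 1 < n → c i % 2 ≠ leftBit n (i + 1) (c (i + 1)) := by
    intro i
    induction i with
    | zero =>
      intro _ h
      have hb := hc 0 (by omega)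
      simp only [true_or, if_true] at hb
      apply H 0 (by omega)
      simp only [pathGuess, if_true]
      simp only [zero_add] at h
      omega
    | succ i ih =>
      intro hi h
      have ih := ih (by omega)
      have hb := hc (i + 1) (by omega)
      rw [if_neg (by omega)] at hb
      apply H (i + 1) (by omega)
      rw [pathGuess, if_neg (by omega), if_neg (by omega), ← h, Nat.add_sub_cancel]
      rw [leftBit, if_neg (by omega)] at ih
      omega
  have hlast := key (n - 2) (by omega)
  have hb := hc (n - 1) (by omega)
  rw [if_pos (by omega)] at hb
  apply H (n - 1) (by omega)
  rw [show n - 2 + 1 = n - 1 by omega, leftBit, if_pos rfl] at hlast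
  rw [pathGuess, if_neg (by omega), if_pos rfl, show n - 1 - 1 = n - 2 by omega]
  omega

/-- On the path `P_n` with endpoints of hatness 2 and internal vertices of
hatness 4 the sages win. -/
theorem path_2_4_4_2_winning (n : ℕ) (hn : 2 ≤ n) :
    HatsWinning (SimpleGraph.pathGraph n)
      (fun v : Fin n => if (v : ℕ) = 0 ∨ (v : ℕ) = n - 1 then 2 else 4) := by
  refine ⟨fun v φ => ⟨pathGuess n (fun i => if hi : i < n then (φ ⟨i, hi⟩ : ℕ) else 0) v,
    pathGuess_lt _ _ _⟩, fun v φ ψ h => ?_, fun φ => ?_⟩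
  · apply Fin.ext
    dsimp only
    refine pathGuess_congr hn v.isLt fun j hj hvj => ?_
    simp only [dif_pos hj]
    rw [h ⟨j, hj⟩ (SimpleGraph.pathGraph_adj.mpr hvj)]
  · obtain ⟨i, hi, h⟩ := exists_pathGuess_eq hn
      (c := fun i => if hi : i < n then (φ ⟨i, hi⟩ : ℕ) else 0) fun i hi => by
        simpa only [dif_pos hi] using (φ ⟨i, hi⟩).isLt
    exact ⟨⟨i, hi⟩, Fin.ext (h.trans (dif_pos hi))⟩
end

section
/- Let G be the graph ('Big bow') on 9 vertices consisting of two 5-cliques sharing exactly one common vertex A (so each clique has 4 vertices besides A, and there are no edges between the two cliques other than through A). Define the hat function h by h(A) = 37 and, in each of the two cliques, one of the four remaining vertices has hatness 4 and the other three have hatness 5. Then the Hats game ⟨G, h⟩ is winning. -/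
/-- The "Big bow" graph: two 5-cliques `{0,1,2,3,4}` and `{4,5,6,7,8}` on `Fin 9`
sharing exactly the common vertex `4`. -/
def bigBow : SimpleGraph (Fin 9) :=
  SimpleGraph.fromRel
    (fun i j => ((i : ℕ) ≤ 4 ∧ (j : ℕ) ≤ 4) ∨ (4 ≤ (i : ℕ) ∧ 4 ≤ (j : ℕ)))

/-- The sages win if each vertex `v` can be given a set `P v` of arrangements, determined by the
closed neighborhood of `v` and by the color of `v` in at most one way once the other colors are
fixed, such that these sets cover all arrangements. -/
theorem HatsWinning.of_cover {V : Type*} [DecidableEq V] (G : SimpleGraph V) (h : V → ℕ)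
    (hpos : ∀ v, 0 < h v) (P : V → ((u : V) → Fin (h u)) → Prop)
    (hlocal : ∀ v φ ψ, φ v = ψ v → (∀ u, G.Adj v u → φ u = ψ u) → (P v φ → P v ψ))
    (hunique : ∀ v φ ψ, (∀ u, u ≠ v → φ u = ψ u) → P v φ → P v ψ → φ v = ψ v)
    (hcover : ∀ φ, ∃ v, P v φ) : HatsWinning G h := by
  classical
  refine ⟨fun v φ => if hc : ∃ c, P v (Function.update φ v c) then hc.choose else ⟨0, hpos v⟩,
    fun v φ ψ hφψ => ?_, fun φ => ?_⟩
  · have key : (fun c => P v (Function.update φ v c)) = fun c => P v (Function.update ψ v c) := by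
      funext c
      refine propext ⟨hlocal _ _ _ (by simp) fun u hu => ?_, hlocal _ _ _ (by simp) fun u hu => ?_⟩
      · simp [Function.update_of_ne hu.ne', hφψ u hu]
      · simp [Function.update_of_ne hu.ne', hφψ u hu]
    have hguess (R S : Fin (h v) → Prop) (hRS : R = S) :
        (if hc : ∃ c, R c then hc.choose else ⟨0, hpos v⟩) =
          if hc : ∃ c, S c then hc.choose else ⟨0, hpos v⟩ := by
      subst hRS; rfl
    exact hguess _ _ key
  · obtain ⟨v, hv⟩ := hcover φ
    have hc : ∃ c, P v (Function.update φ v c) := ⟨φ v, by simpa using hv⟩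
    refine ⟨v, ?_⟩
    simp only [dif_pos hc]
    have := hunique v _ φ (fun u hu => Function.update_of_ne hu _ _) hc.choose_spec hv
    simpa using this

/-- The first coordinate of the corner of the `k`-th of 37 disjoint `3 × 3` squares in the torus
`(ℤ/20)²`. -/
def squareFst (k : ℕ) : ℕ := 20 * k / 37

/-- The second coordinate of the corner of the `k`-th of 37 disjoint `3 × 3` squares in the torus
`(ℤ/20)²`. -/
def squareSnd (k : ℕ) : ℕ := 120 * k / 37 % 20

theorem squareFst_le {k : ℕ} (hk : k < 37) : squareFst k ≤ 20 := by
  unfold squareFst; omega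

theorem squareSnd_le (k : ℕ) : squareSnd k ≤ 20 := by
  unfold squareSnd; omega

set_option maxRecDepth 100000 in
theorem squares_disjoint : ∀ k < 37, ∀ l < 37, k ≠ l →
    (3 ≤ (squareFst k + 20 - squareFst l) % 20 ∧ (squareFst k + 20 - squareFst l) % 20 ≤ 17) ∨
    (3 ≤ (squareSnd k + 20 - squareSnd l) % 20 ∧ (squareSnd k + 20 - squareSnd l) % 20 ≤ 17) := by
  decide +kernel

/-- The residue mod 20 attached to the colors of the first clique, relative to the square chosen by
the color of the common vertex. -/
def offsetFst (n : Fin 9 → ℕ) : ℕ :=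
  (5 * n 0 + 4 * (n 1 + n 2 + n 3) + 20 - squareFst (n 4)) % 20

/-- The residue mod 20 attached to the colors of the second clique, relative to the square chosen by
the color of the common vertex. -/
def offsetSnd (n : Fin 9 → ℕ) : ℕ :=
  (5 * n 5 + 4 * (n 6 + n 7 + n 8) + 20 - squareSnd (n 4)) % 20

/-- The colorings of the big bow on which the given vertex guesses correctly: the common vertex
covers the square of offsets less than 3, and the other vertices of each clique share the offsets
from 3 to 19. -/
def bowCovers : Fin 9 → (Fin 9 → ℕ) → Prop
  | 0, n => 15 ≤ offsetFst n
  | 1, n => 3 ≤ offsetFst n ∧ offsetFst n < 7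
  | 2, n => 7 ≤ offsetFst n ∧ offsetFst n < 11
  | 3, n => 11 ≤ offsetFst n ∧ offsetFst n < 15
  | 4, n => offsetFst n < 3 ∧ offsetSnd n < 3
  | 5, n => 15 ≤ offsetSnd n
  | 6, n => 3 ≤ offsetSnd n ∧ offsetSnd n < 7
  | 7, n => 7 ≤ offsetSnd n ∧ offsetSnd n < 11
  | 8, n => 11 ≤ offsetSnd n ∧ offsetSnd n < 15

theorem bowCovers_local (v : Fin 9) (n m : Fin 9 → ℕ) (hv : n v = m v)
    (hadj : ∀ u, bigBow.Adj v u → n u = m u) (hn : bowCovers v n) : bowCovers v m := by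
  have hclosed (u : Fin 9) (hu : ((v : ℕ) ≤ 4 ∧ (u : ℕ) ≤ 4) ∨ (4 ≤ (v : ℕ) ∧ 4 ≤ (u : ℕ))) :
      n u = m u := by
    by_cases huv : v = u
    · exact huv ▸ hv
    · exact hadj u ⟨huv, Or.inl hu⟩
  have hfst (hv4 : (v : ℕ) ≤ 4) : offsetFst n = offsetFst m := by
    simp [offsetFst, hclosed 0 (by simp [hv4]), hclosed 1 (by simp [hv4]),
      hclosed 2 (by simp [hv4]), hclosed 3 (by simp [hv4]), hclosed 4 (by simp [hv4])]
  have hsnd (hv4 : 4 ≤ (v : ℕ)) : offsetSnd n = offsetSnd m := by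
    simp [offsetSnd, hclosed 4 (by simp [hv4]), hclosed 5 (by simp [hv4]),
      hclosed 6 (by simp [hv4]), hclosed 7 (by simp [hv4]), hclosed 8 (by simp [hv4])]
  fin_cases v <;> simp_all [bowCovers]

theorem bowCovers_unique (v : Fin 9) (n m : Fin 9 → ℕ)
    (hn : ∀ i : Fin 9, n i < if (i : ℕ) = 4 then 37 else if (i : ℕ) = 0 ∨ (i : ℕ) = 5 then 4 else 5)
    (hm : ∀ i : Fin 9, m i < if (i : ℕ) = 4 then 37 else if (i : ℕ) = 0 ∨ (i : ℕ) = 5 then 4 else 5)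
    (hnm : ∀ u, u ≠ v → n u = m u) (hcn : bowCovers v n) (hcm : bowCovers v m) : n v = m v := by
  have hn4 : n 4 < 37 := by simpa using hn 4
  have hm4 : m 4 < 37 := by simpa using hm 4
  have hnv := hn v
  have hmv := hm v
  have h1 := squareFst_le hn4
  have h2 := squareFst_le hm4
  have h3 := squareSnd_le (n 4)
  have h4 := squareSnd_le (m 4)
  have hdisj := squares_disjoint _ hn4 _ hm4
  have e0 := hnm 0
  have e1 := hnm 1
  have e2 := hnm 2
  have e3 := hnm 3
  have e4 := hnm 4
  have e5 := hnm 5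
  have e6 := hnm 6
  have e7 := hnm 7
  have e8 := hnm 8
  clear hn hm hnm
  fin_cases v <;>
    simp [bowCovers, offsetFst, offsetSnd] at * <;>
    first
    | (by_contra hne
       have := hdisj hne
       omega)
    | (simp only [e4] at hcn
       omega)

theorem exists_bowCovers (n : Fin 9 → ℕ) : ∃ v, bowCovers v n := by
  have h1 : offsetFst n < 20 := Nat.mod_lt _ (by norm_num)
  have h2 : offsetSnd n < 20 := Nat.mod_lt _ (by norm_num)
  by_contra! hne
  have c0 := hne 0
  have c1 := hne 1
  have c2 := hne 2
  have c3 := hne 3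
  have c4 := hne 4
  have c5 := hne 5
  have c6 := hne 6
  have c7 := hne 7
  have c8 := hne 8
  simp only [bowCovers] at c0 c1 c2 c3 c4 c5 c6 c7 c8
  omega

/-- The sages win on the "Big bow": the common vertex has hatness 37, and in each
5-clique one of the remaining vertices has hatness 4 and the other three hatness 5. -/
theorem bigBow_winning :
    HatsWinning bigBow
      (fun i => if (i : ℕ) = 4 then 37 else if (i : ℕ) = 0 ∨ (i : ℕ) = 5 then 4 else 5) := by
  refine HatsWinning.of_cover _ _ (fun v => by positivity)
    (fun v φ => bowCovers v fun u => (φ u : ℕ)) (fun v φ ψ hv hadj => ?_)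
    (fun v φ ψ hne hφ hψ => ?_) (fun φ => exists_bowCovers _)
  · exact bowCovers_local v _ _ (congrArg Fin.val hv) fun u hu => congrArg Fin.val (hadj u hu)
  · exact Fin.ext (bowCovers_unique v _ _ (fun i => (φ i).isLt) (fun i => (ψ i).isLt)
      (fun u hu => congrArg Fin.val (hne u hu)) hφ hψ)
end

section
/- Let G_1 and G_2 be finite simple graphs whose vertex sets intersect in exactly one vertex A, and let G be the graph on the union of the two vertex sets whose edge set is the union of the edge sets of G_1 and G_2. Suppose the Hats games ⟨G_1, h_1⟩ and ⟨G_2, h_2⟩ are both losing, and that h_1(A) ≥ h_2(A) = 2. Define h by h(v) = h_1(v) for v ∈ V(G_1) (including A) and h(v) = h_2(v) for v ∈ V(G_2)∖{A}. Then the Hats game ⟨G, h⟩ is losing. -/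
/-- In a losing game, whatever the other vertices do, some coloring of the neighbors of `A`
extends to two arrangements with different colors at `A` in which every vertex other than `A`
guesses wrong. -/
theorem exists_two_colors_of_not_hatsWinning {V : Type*} {G : SimpleGraph V} {h : V → ℕ}
    (hl : ¬ HatsWinning G h) (A : V)
    (f : (v : V) → ((u : V) → Fin (h u)) → Fin (h v))
    (hf : ∀ v, v ≠ A → ∀ φ ψ : (u : V) → Fin (h u),
      (∀ u, G.Adj v u → φ u = ψ u) → f v φ = f v ψ) :
    ∃ φ ψ : (u : V) → Fin (h u), φ A ≠ ψ A ∧ (∀ u, G.Adj A u → φ u = ψ u) ∧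
      ∀ v, v ≠ A → f v φ ≠ φ v ∧ f v ψ ≠ ψ v := by
  classical
  by_contra hcon
  apply hl
  by_cases hne : Nonempty (Fin (h A))
  swap
  · exact ⟨f, fun v φ => (hne ⟨φ A⟩).elim, fun φ => (hne ⟨φ A⟩).elim⟩
  let P : ((u : V) → Fin (h u)) → Fin (h A) → Prop := fun φ c =>
    ∃ χ : (u : V) → Fin (h u), χ A = c ∧ (∀ u, G.Adj A u → χ u = φ u) ∧
      ∀ v, v ≠ A → f v χ ≠ χ v
  refine ⟨Function.update f A (fun φ => Classical.epsilon (P φ)), ?_, ?_⟩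
  · intro v φ ψ hφψ
    by_cases hv : v = A
    · subst hv
      have hP : P φ = P ψ := by
        funext c
        refine propext ⟨?_, ?_⟩
        · rintro ⟨χ, h1, h2, h3⟩
          exact ⟨χ, h1, fun u hu => (h2 u hu).trans (hφψ u hu), h3⟩
        · rintro ⟨χ, h1, h2, h3⟩
          exact ⟨χ, h1, fun u hu => (h2 u hu).trans (hφψ u hu).symm, h3⟩
      simp [hP]
    · simpa [Function.update_of_ne hv] using hf v hv φ ψ hφψ
  · intro φ
    by_contra! hw
    have hwrong : ∀ v, v ≠ A → f v φ ≠ φ v := fun v hv => by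
      simpa [Function.update_of_ne hv] using hw v
    obtain ⟨χ, h1, h2, h3⟩ : P φ (Classical.epsilon (P φ)) :=
      Classical.epsilon_spec (p := P φ) ⟨φ A, φ, rfl, fun _ _ => rfl, hwrong⟩
    have hA := hw A
    rw [Function.update_self, ← h1] at hA
    exact hcon ⟨χ, φ, hA, h2, fun v hv => ⟨h3 v hv, hwrong v hv⟩⟩

/-- A version of `exists_two_colors_of_not_hatsWinning` for a losing game on a part `S` of a
larger graph, in which the colors of the losing game are identified with some of the colors of
the larger game. -/
theorem exists_two_colors_of_subgame {W : Type*} {A : W} {S : Set W} (hA : A ∈ S)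
    {G : SimpleGraph W} {H : SimpleGraph S} {h : W → ℕ} {k : S → ℕ}
    (hh : ∀ w, 0 < h w) (hk : ∀ v, 0 < k v) (hl : ¬ HatsWinning H k)
    (hGH : ∀ v : S, v.1 ≠ A → ∀ u, G.Adj v u → ∃ hu : u ∈ S, H.Adj v ⟨u, hu⟩)
    (e : (v : S) → Fin (k v) → Fin (h v)) (he : ∀ v, Function.Injective (e v))
    (f : (v : W) → ((u : W) → Fin (h u)) → Fin (h v))
    (hf : ∀ (v : W) (φ ψ : (u : W) → Fin (h u)),
      (∀ u, G.Adj v u → φ u = ψ u) → f v φ = f v ψ) :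
    ∃ φ ψ : (u : W) → Fin (h u), φ A ≠ ψ A ∧
      φ A ∈ Set.range (e ⟨A, hA⟩) ∧ ψ A ∈ Set.range (e ⟨A, hA⟩) ∧
      (∀ u : S, H.Adj ⟨A, hA⟩ u → φ u = ψ u) ∧
      ∀ v ∈ S, v ≠ A → f v φ ≠ φ v ∧ f v ψ ≠ ψ v := by
  classical
  let E : ((v : S) → Fin (k v)) → (w : W) → Fin (h w) := fun φ w =>
    if hw : w ∈ S then e ⟨w, hw⟩ (φ ⟨w, hw⟩) else ⟨0, hh w⟩
  have hE : ∀ φ (v : S), E φ v = e v (φ v) := fun φ v => by simp [E]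
  have : ∀ v, Nonempty (Fin (k v)) := fun v => ⟨⟨0, hk v⟩⟩
  obtain ⟨φ, ψ, hne, hag, hwrong⟩ := exists_two_colors_of_not_hatsWinning hl ⟨A, hA⟩
    (fun v φ => Function.invFun (e v) (f v (E φ))) (by
      intro v hv φ ψ hφψ
      have : f v (E φ) = f v (E ψ) := hf _ _ _ fun u hu => by
        obtain ⟨huS, hadj⟩ := hGH v (fun hvA => hv (Subtype.ext hvA)) u hu
        rw [hE φ ⟨u, huS⟩, hE ψ ⟨u, huS⟩, hφψ _ hadj]
      simp only [this])
  have hkey : ∀ (χ : (v : S) → Fin (k v)) (v : S),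
      Function.invFun (e v) (f v (E χ)) ≠ χ v → f v (E χ) ≠ E χ v := by
    intro χ v hχ heq
    rw [heq, hE, Function.leftInverse_invFun (he v)] at hχ
    exact hχ rfl
  refine ⟨E φ, E ψ, ?_, ⟨_, (hE φ ⟨A, hA⟩).symm⟩, ⟨_, (hE ψ ⟨A, hA⟩).symm⟩, ?_, ?_⟩
  · rw [hE φ ⟨A, hA⟩, hE ψ ⟨A, hA⟩]
    exact fun hc => hne (he _ hc)
  · intro u hu
    rw [hE, hE, hag u hu]
  · intro v hv hvA
    have := hwrong ⟨v, hv⟩ (fun hc => hvA (congrArg Subtype.val hc))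
    exact ⟨hkey φ ⟨v, hv⟩ this.1, hkey ψ ⟨v, hv⟩ this.2⟩

/-- Gluing two losing games at a common vertex `A`, where the hatness of `A` in the
second game is 2 and in the first game is at least 2, and keeping the hat function of
the first game at `A`, yields a losing game. -/
theorem glue_losing_games {W : Type*} [Fintype W] (A : W) (V₁ V₂ : Set W)
    (hA₁ : A ∈ V₁) (hA₂ : A ∈ V₂)
    (hcap : V₁ ∩ V₂ = {A}) (hcup : V₁ ∪ V₂ = Set.univ)
    (G₁ : SimpleGraph V₁) (G₂ : SimpleGraph V₂)
    (h₁ : V₁ → ℕ) (h₂ : V₂ → ℕ)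
    (hp₁ : ∀ v, 0 < h₁ v) (hp₂ : ∀ v, 0 < h₂ v)
    (hA2 : h₂ ⟨A, hA₂⟩ = 2) (hA1 : 2 ≤ h₁ ⟨A, hA₁⟩)
    (hl₁ : ¬ HatsWinning G₁ h₁) (hl₂ : ¬ HatsWinning G₂ h₂)
    (G : SimpleGraph W)
    (hG : ∀ u v : W, G.Adj u v ↔
      (∃ (hu : u ∈ V₁) (hv : v ∈ V₁), G₁.Adj ⟨u, hu⟩ ⟨v, hv⟩) ∨
      (∃ (hu : u ∈ V₂) (hv : v ∈ V₂), G₂.Adj ⟨u, hu⟩ ⟨v, hv⟩))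
    (h : W → ℕ)
    (hh₁ : ∀ (w : W) (hw : w ∈ V₁), h w = h₁ ⟨w, hw⟩)
    (hh₂ : ∀ (w : W) (hw : w ∈ V₂), w ≠ A → h w = h₂ ⟨w, hw⟩) :
    ¬ HatsWinning G h := by
  classical
  rintro ⟨f, hf, hwin⟩
  have honly : ∀ w, w ∈ V₁ → w ∈ V₂ → w = A := fun w hw₁ hw₂ => by
    have : w ∈ V₁ ∩ V₂ := ⟨hw₁, hw₂⟩
    simpa [hcap] using this
  have hcover : ∀ w, w ∈ V₁ ∨ w ∈ V₂ := fun w => by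
    have : w ∈ V₁ ∪ V₂ := hcup ▸ Set.mem_univ w
    exact this
  have hpos : ∀ w, 0 < h w := fun w => by
    by_cases hw₁ : w ∈ V₁
    · exact hh₁ w hw₁ ▸ hp₁ _
    · rw [hh₂ w ((hcover w).resolve_left hw₁) fun hwA => hw₁ (hwA ▸ hA₁)]
      exact hp₂ _
  have hG₁ : ∀ v : V₁, v.1 ≠ A → ∀ u, G.Adj v u → ∃ hu : u ∈ V₁, G₁.Adj v ⟨u, hu⟩ := by
    intro v hv u hu
    rcases (hG v u).1 hu with ⟨_, hu, hadj⟩ | ⟨hv₂, _⟩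
    · exact ⟨hu, hadj⟩
    · exact (hv (honly v v.2 hv₂)).elim
  have hG₂ : ∀ v : V₂, v.1 ≠ A → ∀ u, G.Adj v u → ∃ hu : u ∈ V₂, G₂.Adj v ⟨u, hu⟩ := by
    intro v hv u hu
    rcases (hG v u).1 hu with ⟨hv₁, _⟩ | ⟨_, hu, hadj⟩
    · exact (hv (honly v hv₁ v.2)).elim
    · exact ⟨hu, hadj⟩
  obtain ⟨φ₁, ψ₁, hne₁, -, -, hag₁, hwr₁⟩ := exists_two_colors_of_subgame hA₁ hpos hp₁ hl₁ hG₁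
    (fun v => Fin.cast (hh₁ v v.2).symm) (fun v => Fin.cast_injective _) f hf
  have hexists : ∀ v : V₂, ∃ e : Fin (h₂ v) → Fin (h v), Function.Injective e ∧
      (v.1 = A → ∀ i, (e i).val = (φ₁ A).val ∨ (e i).val = (ψ₁ A).val) := by
    rintro ⟨v, hv⟩
    by_cases hvA : v = A
    · subst hvA
      refine ⟨fun i => if i.val = 0 then φ₁ v else ψ₁ v, ?_, ?_⟩
      · intro i j hij
        have hi := i.isLt
        have hj := j.isLt
        apply Fin.ext
        dsimp only at hij
        split_ifs at hij with hi0 hj0 hj0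
        · omega
        · exact (hne₁ hij).elim
        · exact (hne₁ hij.symm).elim
        · omega
      · intro _ i
        dsimp only
        split_ifs
        · exact Or.inl rfl
        · exact Or.inr rfl
    · exact ⟨Fin.cast (hh₂ v hv hvA).symm, Fin.cast_injective _, fun hc => (hvA hc).elim⟩
  choose e he heA using hexists
  have hrange : ∀ c ∈ Set.range (e ⟨A, hA₂⟩), c = φ₁ A ∨ c = ψ₁ A := by
    rintro _ ⟨i, rfl⟩
    exact (heA ⟨A, hA₂⟩ rfl i).imp Fin.ext Fin.ext
  obtain ⟨φ₂, ψ₂, hφ, hψ, hag₂, hwr₂⟩ : ∃ φ₂ ψ₂ : (u : W) → Fin (h u),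
      φ₂ A = φ₁ A ∧ ψ₂ A = ψ₁ A ∧ (∀ u : V₂, G₂.Adj ⟨A, hA₂⟩ u → φ₂ u = ψ₂ u) ∧
      ∀ v ∈ V₂, v ≠ A → f v φ₂ ≠ φ₂ v ∧ f v ψ₂ ≠ ψ₂ v := by
    obtain ⟨φ₂, ψ₂, hne, hφ, hψ, hag, hwr⟩ :=
      exists_two_colors_of_subgame hA₂ hpos hp₂ hl₂ hG₂ e he f hf
    rcases hrange _ hφ with h1 | h1 <;> rcases hrange _ hψ with h2 | h2
    · exact (hne (h1.trans h2.symm)).elim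
    · exact ⟨φ₂, ψ₂, h1, h2, hag, hwr⟩
    · exact ⟨ψ₂, φ₂, h2, h1, fun u hu => (hag u hu).symm, fun v hv hvA => (hwr v hv hvA).symm⟩
    · exact (hne (h1.trans h2.symm)).elim
  let glue : ((u : W) → Fin (h u)) → ((u : W) → Fin (h u)) → (u : W) → Fin (h u) :=
    fun χ₁ χ₂ u => if u ∈ V₁ then χ₁ u else χ₂ u
  have glue_left : ∀ χ₁ χ₂, ∀ u ∈ V₁, glue χ₁ χ₂ u = χ₁ u := fun χ₁ χ₂ u hu => if_pos hu
  have glue_right : ∀ χ₁ χ₂, χ₂ A = χ₁ A → ∀ u ∈ V₂, glue χ₁ χ₂ u = χ₂ u := by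
    intro χ₁ χ₂ hχ u hu
    by_cases hu₁ : u ∈ V₁
    · obtain rfl := honly u hu₁ hu
      rw [glue_left _ _ _ hu₁, hχ]
    · exact if_neg hu₁
  have hlose : ∀ χ₁ χ₂, χ₂ A = χ₁ A → (∀ v ∈ V₁, v ≠ A → f v χ₁ ≠ χ₁ v) →
      (∀ v ∈ V₂, v ≠ A → f v χ₂ ≠ χ₂ v) → f A (glue χ₁ χ₂) = χ₁ A := by
    intro χ₁ χ₂ hχ hw₁ hw₂
    obtain ⟨v, hv⟩ := hwin (glue χ₁ χ₂)
    by_cases hvA : v = A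
    · subst hvA
      rw [hv, glue_left _ _ _ hA₁]
    rcases hcover v with hv₁ | hv₂
    · refine (hw₁ v hv₁ hvA ?_).elim
      rw [← glue_left χ₁ χ₂ v hv₁, ← hv]
      refine hf _ _ _ fun u hu => ?_
      obtain ⟨hu₁, -⟩ := hG₁ ⟨v, hv₁⟩ hvA u hu
      exact (glue_left _ _ _ hu₁).symm
    · refine (hw₂ v hv₂ hvA ?_).elim
      rw [← glue_right χ₁ χ₂ hχ v hv₂, ← hv]
      refine hf _ _ _ fun u hu => ?_
      obtain ⟨hu₂, -⟩ := hG₂ ⟨v, hv₂⟩ hvA u hu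
      exact (glue_right _ _ hχ _ hu₂).symm
  have hsame : f A (glue φ₁ φ₂) = f A (glue ψ₁ ψ₂) := by
    refine hf _ _ _ fun u hu => ?_
    rcases (hG A u).1 hu with ⟨_, hu₁, hadj⟩ | ⟨_, hu₂, hadj⟩
    · rw [glue_left _ _ _ hu₁, glue_left _ _ _ hu₁]
      exact hag₁ ⟨u, hu₁⟩ hadj
    · rw [glue_right _ _ hφ _ hu₂, glue_right _ _ hψ _ hu₂]
      exact hag₂ ⟨u, hu₂⟩ hadj
  apply hne₁
  rw [← hlose φ₁ φ₂ hφ (fun v hv hvA => (hwr₁ v hv hvA).1) fun v hv hvA => (hwr₂ v hv hvA).1,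
    ← hlose ψ₁ ψ₂ hψ (fun v hv hvA => (hwr₁ v hv hvA).2) fun v hv hvA => (hwr₂ v hv hvA).2,
    hsame]
end

section
/- Let C_4 be the 4-cycle with vertices A, B, C, D in cyclic order (edges AB, BC, CD, DA). The Hats game on C_4 is winning when the hatnesses (h(A), h(B), h(C), h(D)) equal (2, 3, 3, 4), and also when they equal (2, 3, 4, 3). (In the language of the Rook check game these are the winning cases on boards L(2×3), R(3×4) and L(2×4), R(3×3), respectively.) -/
/-- A winning strategy on the 4-cycle `0–1–2–3–0` amounts to four guessing functions, each
taking the colors of the two neighbors. -/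
theorem hatsWinning_cycleGraph_four {a b c d : ℕ}
    (gA : Fin b → Fin d → Fin a) (gB : Fin a → Fin c → Fin b)
    (gC : Fin b → Fin d → Fin c) (gD : Fin a → Fin c → Fin d)
    (hg : ∀ (w : Fin a) (x : Fin b) (y : Fin c) (z : Fin d),
      gA x z = w ∨ gB w y = x ∨ gC x z = y ∨ gD w y = z) :
    HatsWinning (SimpleGraph.cycleGraph 4) ![a, b, c, d] := by
  refine ⟨fun v => match v with
    | 0 => fun φ => gA (φ 1) (φ 3)
    | 1 => fun φ => gB (φ 0) (φ 2)
    | 2 => fun φ => gC (φ 1) (φ 3)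
    | 3 => fun φ => gD (φ 0) (φ 2), ?_, ?_⟩
  · intro v φ ψ h
    match v, h with
    | 0, h => exact congrArg₂ gA (h 1 (by decide)) (h 3 (by decide))
    | 1, h => exact congrArg₂ gB (h 0 (by decide)) (h 2 (by decide))
    | 2, h => exact congrArg₂ gC (h 1 (by decide)) (h 3 (by decide))
    | 3, h => exact congrArg₂ gD (h 0 (by decide)) (h 2 (by decide))
  · intro φ
    rcases hg (φ 0) (φ 1) (φ 2) (φ 3) with h | h | h | h
    exacts [⟨0, h⟩, ⟨1, h⟩, ⟨2, h⟩, ⟨3, h⟩]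

/-- Winning cases of the Rook check game, stated as Hats games on the 4-cycle
`0–1–2–3–0` (`A, B, C, D` in cyclic order): the hatnesses `(2, 3, 3, 4)` and
`(2, 3, 4, 3)` are winning (boards `L(2×3), R(3×4)` and `L(2×4), R(3×3)`). -/
theorem rook_check_winning_cases :
    HatsWinning (SimpleGraph.cycleGraph 4) ![2, 3, 3, 4] ∧
    HatsWinning (SimpleGraph.cycleGraph 4) ![2, 3, 4, 3] := by
  constructor
  · exact hatsWinning_cycleGraph_four
      (fun x z => ![![1, 1, 0, 0], ![0, 0, 0, 0], ![1, 1, 1, 0]] x z)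
      (fun w y => ![![2, 2, 0], ![0, 1, 1]] w y)
      (fun x z => ![![1, 0, 1, 2], ![0, 0, 0, 2], ![2, 2, 0, 2]] x z)
      (fun w y => ![![0, 1, 2], ![3, 3, 2]] w y)
      (by decide)
  · exact hatsWinning_cycleGraph_four
      (fun x z => ![![1, 0, 0], ![1, 0, 0], ![1, 1, 1]] x z)
      (fun w y => ![![2, 2, 2, 0], ![1, 0, 0, 1]] w y)
      (fun x z => ![![2, 3, 0], ![3, 1, 2], ![3, 3, 3]] x z)
      (fun w y => ![![0, 0, 0, 2], ![1, 2, 1, 2]] w y)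
      (by decide)
end

section
/- Let C_4 be the 4-cycle with vertices A, B, C, D in cyclic order (edges AB, BC, CD, DA). The Hats game on C_4 is losing when the hatnesses (h(A), h(B), h(C), h(D)) equal any of (2, 4, 3, 4), (2, 3, 3, 5), (2, 3, 4, 4), (2, 3, 5, 3), (3, 3, 3, 4), or (2, 5, 2, 5). (In the language of the Rook check game these are the losing cases on boards L(2×3) R(4×4), L(2×3) R(3×5), L(2×4) R(3×4), L(2×5) R(3×3), L(3×3) R(3×4), and L(2×2) R(5×5), respectively.) -/
namespace RookCheck

open Finset

/-- The cells of a board that a rook placed at `x` does not check. -/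
def unchecked {a c : ℕ} (x : Fin a × Fin c) : Finset (Fin a × Fin c) :=
  {l | x.1 ≠ l.1 ∧ x.2 ≠ l.2}

/-- The cells that at least two of the rooks `q 0, …, q (n - 1)` fail to check. -/
def doublyUnchecked {a c n : ℕ} (q : Fin n → Fin a × Fin c) : Finset (Fin a × Fin c) :=
  {l | ∃ j k, j ≠ k ∧ l ∈ unchecked (q j) ∧ l ∈ unchecked (q k)}

variable {a b c d n : ℕ}

theorem mem_unchecked {x l : Fin a × Fin c} : l ∈ unchecked x ↔ x.1 ≠ l.1 ∧ x.2 ≠ l.2 := by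
  simp [unchecked]

theorem mem_doublyUnchecked {q : Fin n → Fin a × Fin c} {l : Fin a × Fin c} :
    l ∈ doublyUnchecked q ↔ ∃ j k, j ≠ k ∧ l ∈ unchecked (q j) ∧ l ∈ unchecked (q k) := by
  simp [doublyUnchecked]

/-- A winning strategy on the 4-cycle assigns rooks on the left board to every row of the right
board, such that each left cell left unchecked by two rooks of a row determines that row. -/
theorem exists_disjoint_doublyUnchecked [NeZero a] [NeZero b] [NeZero c] [NeZero d]
    (hw : HatsWinning (SimpleGraph.cycleGraph 4) ![a, b, c, d]) :
    ∃ F : Fin b → Fin d → Fin a × Fin c,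
      ∀ p p', p ≠ p' → Disjoint (doublyUnchecked (F p)) (doublyUnchecked (F p')) := by
  obtain ⟨f, hloc, hwin⟩ := hw
  let mk (x : Fin a) (y : Fin b) (z : Fin c) (w : Fin d) (u : Fin 4) : Fin (![a, b, c, d] u) :=
    match u with
    | 0 => x
    | 1 => y
    | 2 => z
    | 3 => w
  let F (p : Fin b) (j : Fin d) : Fin a × Fin c := (f 0 (mk 0 p 0 j), f 2 (mk 0 p 0 j))
  let g (l : Fin a × Fin c) : Fin b := f 1 (mk l.1 0 l.2 0)
  let g' (l : Fin a × Fin c) : Fin d := f 3 (mk l.1 0 l.2 0)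
  have check (l : Fin a × Fin c) (p : Fin b) (j : Fin d) (hl : l ∈ unchecked (F p j)) :
      g l = p ∨ g' l = j := by
    rw [mem_unchecked] at hl
    obtain ⟨v, hv⟩ := hwin (mk l.1 p l.2 j)
    have hlocal (ψ) (h : ∀ u, (SimpleGraph.cycleGraph 4).Adj v u → mk l.1 p l.2 j u = ψ u) :
        f v ψ = mk l.1 p l.2 j v := (hloc v _ ψ h).symm.trans hv
    fin_cases v
    · refine absurd (hlocal (mk 0 p 0 j) fun u hu => ?_) hl.1
      fin_cases u <;> first | rfl | exact absurd hu (by decide)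
    · refine .inl (hlocal (mk l.1 0 l.2 0) fun u hu => ?_)
      fin_cases u <;> first | rfl | exact absurd hu (by decide)
    · refine absurd (hlocal (mk 0 p 0 j) fun u hu => ?_) hl.2
      fin_cases u <;> first | rfl | exact absurd hu (by decide)
    · refine .inr (hlocal (mk l.1 0 l.2 0) fun u hu => ?_)
      fin_cases u <;> first | rfl | exact absurd hu (by decide)
  have pinned (p : Fin b) (l : Fin a × Fin c) (hl : l ∈ doublyUnchecked (F p)) : g l = p := by
    obtain ⟨j, k, hjk, hj, hk⟩ := mem_doublyUnchecked.1 hl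
    rcases check l p j hj with h | h
    · exact h
    rcases check l p k hk with h' | h'
    · exact h'
    · exact absurd (h.symm.trans h') hjk
  exact ⟨F, fun p p' hp => disjoint_left.2 fun l hl hl' =>
    hp ((pinned p l hl).symm.trans (pinned p' l hl'))⟩

theorem sum_card_le_of_disjoint {α : Type*} [Fintype α] [DecidableEq α] {A : Fin b → Finset α}
    (hA : ∀ p p', p ≠ p' → Disjoint (A p) (A p')) : ∑ p, #(A p) ≤ Fintype.card α := by
  rw [← card_biUnion fun p _ p' _ hp => hA p p' hp]
  exact card_le_univ _

/-- The part of `doublyUnchecked q` in row `i`, given by its column coordinates. -/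
def rowDoublyUnchecked (q : Fin n → Fin a × Fin c) (i : Fin a) : Finset (Fin c) :=
  {z | (i, z) ∈ doublyUnchecked q}

theorem mem_rowDoublyUnchecked {q : Fin n → Fin a × Fin c} {i : Fin a} {z : Fin c} :
    z ∈ rowDoublyUnchecked q i ↔
      ∃ j k, j ≠ k ∧ ((q j).1 ≠ i ∧ (q j).2 ≠ z) ∧ (q k).1 ≠ i ∧ (q k).2 ≠ z := by
  simp [rowDoublyUnchecked, mem_doublyUnchecked, mem_unchecked]

theorem sum_card_rowDoublyUnchecked_le {F : Fin b → Fin n → Fin a × Fin c}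
    (hF : ∀ p p', p ≠ p' → Disjoint (doublyUnchecked (F p)) (doublyUnchecked (F p')))
    (i : Fin a) : ∑ p, #(rowDoublyUnchecked (F p) i) ≤ c := by
  refine (sum_card_le_of_disjoint fun p p' hp => disjoint_left.2 fun z hz hz' => ?_).trans_eq
    (Fintype.card_fin c)
  simp only [rowDoublyUnchecked, mem_filter_univ] at hz hz'
  exact disjoint_left.1 (hF p p' hp) hz hz'

theorem le_card_rowDoublyUnchecked_add_two (q : Fin n → Fin a × Fin c) (i : Fin a)
    (h : 2 ≤ #{j | (q j).1 ≠ i}) : c ≤ #(rowDoublyUnchecked q i) + 2 := by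
  obtain ⟨j, hj, k, hk, hjk⟩ := one_lt_card.1 h
  rw [mem_filter_univ] at hj hk
  have hsub : (rowDoublyUnchecked q i)ᶜ ⊆ {(q j).2, (q k).2} := fun z hz => by
    rw [mem_compl, mem_rowDoublyUnchecked] at hz
    by_contra hz'
    simp only [mem_insert, mem_singleton, not_or] at hz'
    exact hz ⟨j, k, hjk, ⟨hj, Ne.symm hz'.1⟩, hk, Ne.symm hz'.2⟩
  have hcard := (card_le_card hsub).trans card_le_two
  rw [card_compl, Fintype.card_fin] at hcard
  omega

theorem le_card_rowDoublyUnchecked_add_one (q : Fin n → Fin a × Fin c) (i : Fin a)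
    (h : 3 ≤ #{j | (q j).1 ≠ i}) : c ≤ #(rowDoublyUnchecked q i) + 1 := by
  obtain ⟨j, k, m, hj, hk, hm, hjk, hjm, hkm⟩ := two_lt_card_iff.1 h
  rw [mem_filter_univ] at hj hk hm
  have hcard : #(rowDoublyUnchecked q i)ᶜ ≤ 1 := card_le_one.2 fun z hz z' hz' => by
    have two_eq (y : Fin c) (hy : y ∈ (rowDoublyUnchecked q i)ᶜ) :
        ((q j).2 = y ∨ (q k).2 = y) ∧ ((q j).2 = y ∨ (q m).2 = y) ∧
          ((q k).2 = y ∨ (q m).2 = y) := by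
      rw [mem_compl, mem_rowDoublyUnchecked] at hy
      refine ⟨?_, ?_, ?_⟩ <;> by_contra! hne
      · exact hy ⟨j, k, hjk, ⟨hj, hne.1⟩, hk, hne.2⟩
      · exact hy ⟨j, m, hjm, ⟨hj, hne.1⟩, hm, hne.2⟩
      · exact hy ⟨k, m, hkm, ⟨hk, hne.1⟩, hm, hne.2⟩
    have := two_eq z hz
    have := two_eq z' hz'
    grind
  rw [card_compl, Fintype.card_fin] at hcard
  omega

theorem card_row_ne_zero_add_card_row_ne_one (q : Fin n → Fin 2 × Fin c) :
    #{j | (q j).1 ≠ 0} + #{j | (q j).1 ≠ 1} = n := by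
  have h : ∀ i : Fin 2, i ≠ 1 ↔ ¬ i ≠ 0 := by decide
  simp only [h (q _).1]
  rw [card_filter_add_card_filter_not, card_univ, Fintype.card_fin]

/-- The number of doubly unchecked cells in the two rows, for rooks on a board with two rows. -/
theorem exists_card_rowDoublyUnchecked (q : Fin n → Fin 2 × Fin c) :
    ∃ m₀ m₁, m₀ + m₁ = n ∧
      (2 ≤ m₀ → c ≤ #(rowDoublyUnchecked q 0) + 2) ∧
      (3 ≤ m₀ → c ≤ #(rowDoublyUnchecked q 0) + 1) ∧
      (2 ≤ m₁ → c ≤ #(rowDoublyUnchecked q 1) + 2) ∧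
      (3 ≤ m₁ → c ≤ #(rowDoublyUnchecked q 1) + 1) :=
  ⟨_, _, card_row_ne_zero_add_card_row_ne_one q,
    le_card_rowDoublyUnchecked_add_two q 0, le_card_rowDoublyUnchecked_add_one q 0,
    le_card_rowDoublyUnchecked_add_two q 1, le_card_rowDoublyUnchecked_add_one q 1⟩

theorem card_unchecked_three (x : Fin 3 × Fin 3) : #(unchecked x) = 4 := by
  revert x
  decide

theorem card_unchecked_inter_three_ne (x y : Fin 3 × Fin 3) :
    #(unchecked x ∩ unchecked y) ≠ 3 := by
  revert x y
  decide +kernel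

theorem four_le_card_doublyUnchecked (q : Fin 4 → Fin 3 × Fin 3) : 4 ≤ #(doublyUnchecked q) := by
  by_contra! hlt
  have hsum : ∑ j, #(unchecked (q j) \ doublyUnchecked q) ≤ #(doublyUnchecked q)ᶜ := by
    rw [← card_biUnion]
    · refine card_le_card (biUnion_subset.2 fun j _ l hl => ?_)
      exact mem_compl.2 (mem_sdiff.1 hl).2
    · refine fun j _ k _ hjk => disjoint_left.2 fun l hl hl' => ?_
      rw [mem_sdiff] at hl hl'
      exact hl.2 (mem_doublyUnchecked.2 ⟨j, k, hjk, hl.1, hl'.1⟩)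
  have hsplit (j) := card_sdiff_add_card_inter (unchecked (q j)) (doublyUnchecked q)
  simp only [card_unchecked_three] at hsplit
  have hpair (j k) (hjk : j ≠ k) (hcard : #(doublyUnchecked q) = 3)
      (hj : #(unchecked (q j) \ doublyUnchecked q) ≤ 1)
      (hk : #(unchecked (q k) \ doublyUnchecked q) ≤ 1) : False := by
    have hsub (m) (hm : #(unchecked (q m) \ doublyUnchecked q) ≤ 1) :
        doublyUnchecked q ⊆ unchecked (q m) :=
      inter_eq_right.1 (eq_of_subset_of_card_le inter_subset_right (by have := hsplit m; omega))
    refine card_unchecked_inter_three_ne (q j) (q k) (Eq.trans (congrArg card ?_) hcard)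
    refine Subset.antisymm (fun l hl => ?_) (subset_inter (hsub j hj) (hsub k hk))
    exact mem_doublyUnchecked.2 ⟨j, k, hjk, mem_inter.1 hl⟩
  have hlow (j) : 4 ≤ #(unchecked (q j) \ doublyUnchecked q) + #(doublyUnchecked q) := by
    have := hsplit j
    have : #(unchecked (q j) ∩ doublyUnchecked q) ≤ _ := card_le_card inter_subset_right
    omega
  rw [Fin.sum_univ_four, card_compl, Fintype.card_prod, Fintype.card_fin] at hsum
  have := hlow 0
  have := hlow 1
  have := hlow 2
  have := hlow 3
  have hcard : #(doublyUnchecked q) = 3 := by omega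
  have htwo (j k) (hjk : j ≠ k) : 2 ≤ #(unchecked (q j) \ doublyUnchecked q) ∨
      2 ≤ #(unchecked (q k) \ doublyUnchecked q) := by
    by_contra! h
    exact hpair j k hjk hcard (Nat.le_of_lt_succ h.1) (Nat.le_of_lt_succ h.2)
  have := htwo 0 1 (by decide)
  have := htwo 0 2 (by decide)
  have := htwo 0 3 (by decide)
  have := htwo 1 2 (by decide)
  have := htwo 1 3 (by decide)
  have := htwo 2 3 (by decide)
  clear hlt hpair hsplit
  omega

theorem not_hatsWinning_three_three_three_four :
    ¬ HatsWinning (SimpleGraph.cycleGraph 4) ![3, 3, 3, 4] := fun hw => by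
  obtain ⟨F, hF⟩ := exists_disjoint_doublyUnchecked hw
  have hsum := sum_card_le_of_disjoint hF
  rw [Fin.sum_univ_three, Fintype.card_prod, Fintype.card_fin] at hsum
  have h₀ := four_le_card_doublyUnchecked (F 0)
  have h₁ := four_le_card_doublyUnchecked (F 1)
  have h₂ := four_le_card_doublyUnchecked (F 2)
  omega

/-- A losing criterion for boards `L(2×c)`, obtained by counting doubly unchecked cells by row. -/
theorem not_hatsWinning_two [NeZero b] [NeZero c] [NeZero d]
    (hcount : ∀ r₀ r₁ : Fin b → ℕ, ∑ p, r₀ p ≤ c → ∑ p, r₁ p ≤ c →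
      (∀ p, ∃ m₀ m₁, m₀ + m₁ = d ∧ (2 ≤ m₀ → c ≤ r₀ p + 2) ∧ (3 ≤ m₀ → c ≤ r₀ p + 1) ∧
        (2 ≤ m₁ → c ≤ r₁ p + 2) ∧ (3 ≤ m₁ → c ≤ r₁ p + 1)) → False) :
    ¬ HatsWinning (SimpleGraph.cycleGraph 4) ![2, b, c, d] := fun hw => by
  obtain ⟨F, hF⟩ := exists_disjoint_doublyUnchecked hw
  exact hcount _ _ (sum_card_rowDoublyUnchecked_le hF 0) (sum_card_rowDoublyUnchecked_le hF 1)
    fun p => exists_card_rowDoublyUnchecked (F p)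

theorem not_hatsWinning_two_four_three_four :
    ¬ HatsWinning (SimpleGraph.cycleGraph 4) ![2, 4, 3, 4] :=
  not_hatsWinning_two fun r₀ r₁ h₀ h₁ h => by
    have hp (p) : 2 ≤ r₀ p + r₁ p := by
      obtain ⟨m₀, m₁, hm⟩ := h p
      omega
    have := sum_le_sum fun p (_ : p ∈ univ) => hp p
    simp only [sum_add_distrib, sum_const, card_univ, Fintype.card_fin, smul_eq_mul] at this
    omega

theorem not_hatsWinning_two_three_three_five :
    ¬ HatsWinning (SimpleGraph.cycleGraph 4) ![2, 3, 3, 5] :=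
  not_hatsWinning_two fun r₀ r₁ h₀ h₁ h => by
    have hp (p) : 2 ≤ r₀ p ∨ 2 ≤ r₁ p := by
      obtain ⟨m₀, m₁, hm⟩ := h p
      omega
    have := hp 0
    have := hp 1
    have := hp 2
    rw [Fin.sum_univ_three] at h₀ h₁
    omega

theorem not_hatsWinning_two_three_four_four :
    ¬ HatsWinning (SimpleGraph.cycleGraph 4) ![2, 3, 4, 4] :=
  not_hatsWinning_two fun r₀ r₁ h₀ h₁ h => by
    have hp (p) : 3 ≤ r₀ p + r₁ p := by
      obtain ⟨m₀, m₁, hm⟩ := h p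
      omega
    have := sum_le_sum fun p (_ : p ∈ univ) => hp p
    simp only [sum_add_distrib, sum_const, card_univ, Fintype.card_fin, smul_eq_mul] at this
    omega

theorem not_hatsWinning_two_three_five_three :
    ¬ HatsWinning (SimpleGraph.cycleGraph 4) ![2, 3, 5, 3] :=
  not_hatsWinning_two fun r₀ r₁ h₀ h₁ h => by
    have hp (p) : 3 ≤ r₀ p ∨ 3 ≤ r₁ p := by
      obtain ⟨m₀, m₁, hm⟩ := h p
      omega
    have := hp 0
    have := hp 1
    have := hp 2
    rw [Fin.sum_univ_three] at h₀ h₁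
    omega

theorem not_hatsWinning_two_five_two_five :
    ¬ HatsWinning (SimpleGraph.cycleGraph 4) ![2, 5, 2, 5] :=
  not_hatsWinning_two fun r₀ r₁ h₀ h₁ h => by
    have hp (p) : 1 ≤ r₀ p + r₁ p := by
      obtain ⟨m₀, m₁, hm⟩ := h p
      omega
    have := sum_le_sum fun p (_ : p ∈ univ) => hp p
    simp only [sum_add_distrib, sum_const, card_univ, Fintype.card_fin, smul_eq_mul] at this
    omega

end RookCheck

/-- Losing cases of the Rook check game, stated as Hats games on the 4-cycle
`0–1–2–3–0` (`A, B, C, D` in cyclic order): the hatnesses `(2,4,3,4)`, `(2,3,3,5)`,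
`(2,3,4,4)`, `(2,3,5,3)`, `(3,3,3,4)` and `(2,5,2,5)` are all losing
(boards `L(2×3) R(4×4)`, `L(2×3) R(3×5)`, `L(2×4) R(3×4)`, `L(2×5) R(3×3)`,
`L(3×3) R(3×4)` and `L(2×2) R(5×5)`). -/
theorem rook_check_losing_cases :
    ¬ HatsWinning (SimpleGraph.cycleGraph 4) ![2, 4, 3, 4] ∧
    ¬ HatsWinning (SimpleGraph.cycleGraph 4) ![2, 3, 3, 5] ∧
    ¬ HatsWinning (SimpleGraph.cycleGraph 4) ![2, 3, 4, 4] ∧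
    ¬ HatsWinning (SimpleGraph.cycleGraph 4) ![2, 3, 5, 3] ∧
    ¬ HatsWinning (SimpleGraph.cycleGraph 4) ![3, 3, 3, 4] ∧
    ¬ HatsWinning (SimpleGraph.cycleGraph 4) ![2, 5, 2, 5] := by
  open RookCheck in
  exact ⟨not_hatsWinning_two_four_three_four, not_hatsWinning_two_three_three_five,
    not_hatsWinning_two_three_four_four, not_hatsWinning_two_three_five_three,
    not_hatsWinning_three_three_three_four, not_hatsWinning_two_five_two_five⟩
end

section
/- Let G be the cycle C_n (n ≥ 3) and let h be a hat function with 2 ≤ h(v) ≤ 4 for every vertex v, and let A be a vertex with h(A) = 2. Then the Hats game ⟨G, h⟩ is winning in each of the following cases: (1) n = 3; (2) there exists a vertex B ≠ A with h(B) = 2; (3) both neighbors of A have hatness 3; (4) one neighbor B of A has hatness 3 and the vertex C ≠ A adjacent to B also has hatness 3. -/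
/-- The game on a cycle whose vertices are numbered by the naturals modulo `n`, with hat colors
read off as natural numbers `x i < H i`: some guessing rule, in which the vertex `i + 1` sees
`x i` and `x (i + 2)`, always makes one of the vertices `1, …, n` guess correctly. -/
def CyclicallyWinning (n : ℕ) (H : ℕ → ℕ) : Prop :=
  ∃ f : ℕ → ℕ → ℕ → ℕ, ∀ x : ℕ → ℕ, x n = x 0 → x (n + 1) = x 1 → (∀ i, x i < H i) →
    ∃ i < n, f (i + 1) (x i) (x (i + 2)) = x (i + 1)

/-- A winning rule along a closed walk visiting each of its `n` vertices once wins the game. -/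
theorem CyclicallyWinning.hatsWinning {V : Type*} {G : SimpleGraph V} {h : V → ℕ}
    (hpos : ∀ v, 0 < h v) {n : ℕ} {c : ℕ → V} (hadj : ∀ i, G.Adj (c i) (c (i + 1)))
    (hinj : ∀ i < n, ∀ j < n, c (i + 1) = c (j + 1) → i = j)
    (hc₀ : c n = c 0) (hc₁ : c (n + 1) = c 1) (hwin : CyclicallyWinning n (fun i => h (c i))) :
    HatsWinning G h := by
  classical
  obtain ⟨f, hf⟩ := hwin
  refine ⟨fun v φ => if hv : ∃ i < n, c (i + 1) = v then
    ⟨f (hv.choose + 1) (φ (c hv.choose)) (φ (c (hv.choose + 2))) % h v, Nat.mod_lt _ (hpos v)⟩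
    else ⟨0, hpos v⟩, ?_, ?_⟩
  · intro v φ ψ hφψ
    by_cases hv : ∃ i < n, c (i + 1) = v
    · have hv' := hv.choose_spec.2
      have h₁ : φ (c hv.choose) = ψ (c hv.choose) := by
        apply hφψ
        have := (hadj hv.choose).symm
        rwa [hv'] at this
      have h₂ : φ (c (hv.choose + 2)) = ψ (c (hv.choose + 2)) := by
        apply hφψ
        have := hadj (hv.choose + 1)
        rwa [hv'] at this
      simp only [dif_pos hv, h₁, h₂]
    · simp only [dif_neg hv]
  · intro φ
    obtain ⟨i, hi, hfi⟩ := hf (fun i => φ (c i)) (by rw [hc₀]) (by rw [hc₁])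
      (fun i => (φ (c i)).isLt)
    refine ⟨c (i + 1), ?_⟩
    have hv : ∃ j < n, c (j + 1) = c (i + 1) := ⟨i, hi, rfl⟩
    have hj : hv.choose = i := hinj _ hv.choose_spec.1 _ hi hv.choose_spec.2
    ext
    simp only [dif_pos hv]
    rw [hj, hfi]
    exact Nat.mod_eq_of_lt (φ (c (i + 1))).isLt

/-- The guess of the vertex `i` in a chain `s + 1, …, t` of vertices of hatness 4. A color is
regarded as the pair of bits `(x % 2, x / 2)`. Vertex `i` guesses the negated second bit of its
predecessor and the first bit of its successor, with `P` and `Q` replacing these at the ends. -/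
def chainGuess (s t : ℕ) (P Q : ℕ → ℕ) (i w y : ℕ) : ℕ :=
  (if i = s + 1 then P w else 1 - w / 2) + 2 * (if i = t then Q y else y % 2)

/-- If nobody in the chain guesses correctly, then the first bit of the chain differs from the
prediction `P` or its last bit differs from the prediction `Q`. -/
theorem chainGuess_ends {s t : ℕ} (hst : s < t) {P Q : ℕ → ℕ} {x : ℕ → ℕ}
    (hx : ∀ i, s ≤ i → i < t → x (i + 1) < 4)
    (hlose : ∀ i, s ≤ i → i < t → chainGuess s t P Q (i + 1) (x i) (x (i + 2)) ≠ x (i + 1))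
    (hP : x (s + 1) % 2 = P (x s)) : x t / 2 ≠ Q (x (t + 1)) := by
  have key : ∀ k, s + k < t →
      x (s + k + 1) % 2 = if s + k + 1 = s + 1 then P (x (s + k)) else 1 - x (s + k) / 2 := by
    intro k
    induction k with
    | zero => intro _; simpa using hP
    | succ k ih =>
      intro hk
      have ih := ih (by omega)
      have hl := hlose (s + k) (by omega) (by omega)
      have h4 := hx (s + k) (by omega) (by omega)
      unfold chainGuess at hl
      rw [← ih, if_neg (by omega)] at hl
      rw [if_neg (by omega)]
      simp only [← add_assoc] at *
      rw [show s + k + 2 = s + k + 1 + 1 from rfl] at hl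
      omega
  obtain ⟨k, rfl⟩ : ∃ k, t = s + k + 1 := ⟨t - s - 1, by omega⟩
  have hk := key k (by omega)
  have hl := hlose (s + k) (by omega) (by omega)
  unfold chainGuess at hl
  rw [← hk, if_pos rfl] at hl
  intro hQ
  apply hl
  rw [show s + k + 2 = s + k + 1 + 1 from rfl, ← hQ]
  omega

theorem cyclicallyWinning_three {H : ℕ → ℕ} (hH : ∀ i, H i ≤ 4) (h₀ : H 0 = 2) :
    CyclicallyWinning 3 H := by
  refine ⟨fun i w y => if i = 1 then (2 + (8 - 2 * w - y)) % 4
    else if i = 2 then (3 + (8 - w - 2 * y)) % 4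
    else if (w + y) % 4 ≤ 1 then 0 else 1, fun x hx₀ _ hx => ?_⟩
  by_contra! hlose
  have l₀ := hlose 0 (by omega)
  have l₁ := hlose 1 (by omega)
  have l₂ := hlose 2 (by omega)
  have b₀ := hx 0
  have b₁ := (hx 1).trans_le (hH 1)
  have b₂ := (hx 2).trans_le (hH 2)
  norm_num at l₀ l₁ l₂ hx₀
  rw [show x 4 = x 1 by assumption] at l₂
  rw [hx₀] at l₁ l₂
  generalize x 0 = a at *
  generalize x 1 = b at *
  generalize x 2 = c at *
  rw [h₀] at b₀
  split_ifs at l₂ <;> omega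

theorem cyclicallyWinning_of_two_two {n k : ℕ} {H : ℕ → ℕ} (hH : ∀ i, H i ≤ 4) (h₀ : H 0 = 2)
    (hk₀ : 0 < k) (hkn : k < n) (hk : H k = 2) : CyclicallyWinning n H := by
  refine ⟨fun i w y => if i = n then y % 2 else if i = k then (if k = 1 then 1 - w else 1 - w / 2)
    else chainGuess 0 (k - 1) (fun w => 1 - w) (fun y => y) i w y, fun x hx₀ hx₁ hx => ?_⟩
  by_contra! hlose
  have b₀ := hx 0
  have bk := hx k
  obtain ⟨m, rfl⟩ : ∃ m, n = m + 1 := ⟨n - 1, by omega⟩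
  obtain ⟨k, rfl⟩ : ∃ j, k = j + 1 := ⟨k - 1, by omega⟩
  have l₀ := hlose m (by omega)
  have lk := hlose k (by omega)
  rw [if_pos rfl, hx₀, show m + 2 = m + 1 + 1 from rfl, hx₁] at l₀
  rw [if_neg (by omega), if_pos rfl] at lk
  rcases Nat.eq_zero_or_pos k with rfl | hk₁
  · norm_num at *
    omega
  · rw [if_neg (by omega)] at lk
    have := chainGuess_ends (s := 0) (t := k) hk₁ (P := fun w => 1 - w) (Q := fun y => y)
      (x := x) (fun i _ _ => (hx _).trans_le (hH _))
      (fun i _ hi => by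
        have := hlose i (by omega)
        rwa [if_neg (by omega), if_neg (by omega)] at this)
      (by rw [zero_add]; omega)
    have := (hx k).trans_le (hH k)
    omega

theorem cyclicallyWinning_of_three_two_three {m : ℕ} {H : ℕ → ℕ} (hH : ∀ i, H i ≤ 4)
    (h₀ : H 0 = 2) (h₁ : H 1 = 3) (hm : H (m + 3) = 3) : CyclicallyWinning (m + 4) H := by
  refine ⟨fun i w y => if i = 1 then (if w = 0 then 0 else 1 + y % 2)
    else if i = m + 3 then (if y = 0 then 0 else 1 + w / 2)
    else if i = m + 4 then (if w = 0 ∨ y = 0 then 1 else 0)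
    else chainGuess 1 (m + 2) (fun w => 2 - w) (fun y => 2 - y) i w y, fun x hx₀ hx₁ hx => ?_⟩
  by_contra! hlose
  have b₀ := hx 0
  have b₁ := hx 1
  have b₂ := (hx 2).trans_le (hH 2)
  have bm := hx (m + 3)
  have bm' := (hx (m + 2)).trans_le (hH (m + 2))
  have l₀ := hlose 0 (by omega)
  have lm := hlose (m + 2) (by omega)
  have ln := hlose (m + 3) (by omega)
  have := chainGuess_ends (s := 1) (t := m + 2) (by omega) (P := fun w => 2 - w)
    (Q := fun y => 2 - y) (x := x) (fun i _ _ => (hx _).trans_le (hH _))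
    (fun i _ hi => by
      have := hlose i (by omega)
      rwa [if_neg (by omega), if_neg (by omega), if_neg (by omega)] at this)
  rw [h₀] at b₀
  rw [h₁] at b₁
  rw [hm] at bm
  simp only [add_assoc] at *
  norm_num at l₀ lm ln this hx₀ hx₁
  rw [hx₀] at lm ln
  rw [hx₁] at ln
  split_ifs at l₀ lm ln <;> omega

theorem cyclicallyWinning_of_two_three_three {m : ℕ} {H : ℕ → ℕ} (hH : ∀ i, H i ≤ 4)
    (h₀ : H 0 = 2) (h₁ : H 1 = 3) (h₂ : H 2 = 3) : CyclicallyWinning (m + 4) H := by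
  refine ⟨fun i w y => if i = 1 then (if y = 0 then 2 else w)
    else if i = 2 then (if w = 2 then 1 + y % 2 else 0)
    else if i = m + 4 then (if y = 2 then 1 - w / 2 else 1 - y)
    else chainGuess 2 (m + 3) (fun w => 2 - w) (fun y => y) i w y, fun x hx₀ hx₁ hx => ?_⟩
  by_contra! hlose
  have b₀ := hx 0
  have b₁ := hx 1
  have b₂ := hx 2
  have b₃ := (hx 3).trans_le (hH 3)
  have bm := (hx (m + 3)).trans_le (hH (m + 3))
  have l₀ := hlose 0 (by omega)
  have l₁ := hlose 1 (by omega)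
  have ln := hlose (m + 3) (by omega)
  have := chainGuess_ends (s := 2) (t := m + 3) (by omega) (P := fun w => 2 - w)
    (Q := fun y => y) (x := x) (fun i _ _ => (hx _).trans_le (hH _))
    (fun i _ hi => by
      have := hlose i (by omega)
      rwa [if_neg (by omega), if_neg (by omega), if_neg (by omega)] at this)
  rw [h₀] at b₀
  rw [h₁] at b₁
  rw [h₂] at b₂
  simp only [add_assoc] at *
  norm_num at l₀ l₁ ln this hx₀ hx₁
  rw [hx₀] at ln this
  rw [hx₁] at ln
  split_ifs at l₀ l₁ ln <;> omega

theorem Fin.val_nsmul_one {n i : ℕ} (hi : i < n + 3) :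
    (i • (1 : Fin (n + 3))).val = i := by
  induction i with
  | zero => simp
  | succ i ih => rw [succ_nsmul, Fin.val_add, ih (by omega), Fin.val_one, Nat.mod_eq_of_lt hi]

/-- Walking around the cycle graph in either direction reduces its game to the cyclic one. -/
theorem hatsWinning_cycleGraph {n : ℕ} {h : Fin (n + 3) → ℕ} (hpos : ∀ v, 0 < h v)
    (A d : Fin (n + 3)) (hd : d = 1 ∨ d = -1)
    (hwin : CyclicallyWinning (n + 3) (fun i => h (A + i • d))) :
    HatsWinning (SimpleGraph.cycleGraph (n + 3)) h := by
  have hn : (n + 3) • d = 0 := by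
    simpa using card_nsmul_eq_zero' (x := d)
  refine hwin.hatsWinning (c := fun i => A + i • d) hpos (fun i => ?_) (fun i hi j hj hij => ?_)
    ?_ ?_
  · rw [SimpleGraph.cycleGraph_adj, succ_nsmul]
    rcases hd with rfl | rfl
    · right; abel
    · left; abel
  · simp only [succ_nsmul, ← add_assoc, add_left_inj, add_right_inj] at hij
    have h1 : i • (1 : Fin (n + 3)) = j • 1 := by
      rcases hd with rfl | rfl
      · exact hij
      · simpa using hij
    rw [← Fin.val_nsmul_one hi, ← Fin.val_nsmul_one hj, h1]
  · simp only [hn, zero_nsmul]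
  · simp only [succ_nsmul _ (n + 3), hn, zero_add, one_nsmul]

/-- Winning cases on the cycle `C_n` for hat functions with values in `{2, 3, 4}`
containing a vertex `A` of hatness 2. -/
theorem cycle_winning_cases (n : ℕ) (hn : 3 ≤ n) (h : Fin n → ℕ)
    (hb : ∀ v, 2 ≤ h v ∧ h v ≤ 4) (A : Fin n) (hA : h A = 2)
    (hcase :
      n = 3 ∨
      (∃ B, B ≠ A ∧ h B = 2) ∨
      (∀ B, (SimpleGraph.cycleGraph n).Adj A B → h B = 3) ∨
      (∃ B C, (SimpleGraph.cycleGraph n).Adj A B ∧ (SimpleGraph.cycleGraph n).Adj B C ∧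
        C ≠ A ∧ h B = 3 ∧ h C = 3)) :
    HatsWinning (SimpleGraph.cycleGraph n) h := by
  obtain ⟨m, rfl⟩ : ∃ m, n = m + 3 := ⟨n - 3, by omega⟩
  have hpos : ∀ v, 0 < h v := fun v => by have := (hb v).1; omega
  rcases Nat.eq_zero_or_pos m with rfl | hm
  · exact hatsWinning_cycleGraph hpos A 1 (.inl rfl)
      (cyclicallyWinning_three (fun i => (hb _).2) (by simpa using hA))
  obtain ⟨m, rfl⟩ : ∃ k, m = k + 1 := ⟨m - 1, by omega⟩
  rcases hcase with h3 | ⟨B, hBA, hB⟩ | hnbr | ⟨B, C, hAB, hBC, hCA, hB, hC⟩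
  · omega
  · refine hatsWinning_cycleGraph hpos A 1 (.inl rfl)
      (cyclicallyWinning_of_two_two (k := (B - A).val) (fun i => (hb _).2) (by simpa using hA)
        ?_ (B - A).isLt ?_)
    · exact Fin.pos_iff_ne_zero.mpr (sub_ne_zero.mpr hBA)
    · have : (B - A).val • (1 : Fin (m + 1 + 3)) = B - A := by
        exact Fin.ext (Fin.val_nsmul_one (B - A).isLt)
      simp only [this, add_sub_cancel, hB]
  · refine hatsWinning_cycleGraph hpos A 1 (.inl rfl)
      (cyclicallyWinning_of_three_two_three (m := m) (fun i => (hb _).2) (by simpa using hA)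
        (hnbr _ ?_) (hnbr _ ?_))
    · rw [SimpleGraph.cycleGraph_adj]
      right; simp
    · have : (m + 3 + 1) • (1 : Fin (m + 1 + 3)) = 0 := by
        simpa using card_nsmul_eq_zero' (x := (1 : Fin (m + 1 + 3)))
      rw [SimpleGraph.cycleGraph_adj, eq_neg_of_add_eq_zero_left ((succ_nsmul _ _).symm.trans this)]
      left; simp
  · obtain ⟨d, hd, rfl⟩ : ∃ d : Fin (m + 1 + 3), (d = 1 ∨ d = -1) ∧ B = A + d := by
      rw [SimpleGraph.cycleGraph_adj] at hAB
      refine ⟨B - A, ?_, by abel⟩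
      rcases hAB with hAB | hAB
      · right; rw [← hAB]; abel
      · left; exact hAB
    have hC' : C = A + 2 • d := by
      rw [SimpleGraph.cycleGraph_adj, sub_eq_iff_eq_add, sub_eq_iff_eq_add] at hBC
      rcases hd with rfl | rfl <;> rcases hBC with hBC | hBC
      · exact absurd (add_left_cancel ((add_comm _ _).trans hBC)).symm hCA
      · rw [hBC, two_nsmul]; abel
      · rw [two_nsmul, ← add_assoc, hBC]; abel
      · exact absurd (by rw [hBC]; abel) hCA
    refine hatsWinning_cycleGraph hpos A d hd
      (cyclicallyWinning_of_two_three_three (m := m) (fun i => (hb _).2) (by simpa using hA)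
        (by simpa using hB) (by simpa [← hC'] using hC))
end
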